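/- arXiv:2405.02739 — 3 statements merged into one kernel-verified Lean document; each statement's English description precedes it below -/
import Mathlib

section
/- Two representations M and N of the equioriented type A_n quiver over ℂ are isomorphic if and only if r^M_{i,j} = r^N_{i,j} for all 1 ≤ i ≤ j ≤ n. -/
open Module

/-- A representation of the equioriented type `A_n` quiver over `ℂ`: finite-dimensional
complex vector spaces `V i` (only the indices `1 ≤ i ≤ n` carry content, the spaces at
index `0` and at indices `> n` are required to be trivial) together with linear maps
`f i : V i → V (i+1)`. -/
structure ARep (n : ℕ) where
  V : ℕ → Type
  [instAddCommGroup : ∀ i, AddCommGroup (V i)]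
  [instModule : ∀ i, Module ℂ (V i)]
  [instFiniteDimensional : ∀ i, FiniteDimensional ℂ (V i)]
  f : ∀ i, V i →ₗ[ℂ] V (i + 1)
  triv : ∀ i, i = 0 ∨ n < i → Subsingleton (V i)

attribute [instance] ARep.instAddCommGroup ARep.instModule ARep.instFiniteDimensional

namespace ARep

/-- The composite map `f_{i,i+k} : M_i → M_{i+k}` (the identity for `k = 0`). -/
noncomputable def F {n : ℕ} (M : ARep n) (i : ℕ) : (k : ℕ) → (M.V i →ₗ[ℂ] M.V (i + k))
  | 0 => LinearMap.id
  | (k + 1) => (M.f (i + k)).comp (M.F i k)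

/-- The rank sequence `r^M_{i,j} = rank f_{i,j}`.  (For `i = 0` the source space is
trivial and for `j = n+1` the target space is trivial, so the conventions
`r^M_{0,·} = 0 = r^M_{·,n+1}` hold automatically.) -/
noncomputable def r {n : ℕ} (M : ARep n) (i j : ℕ) : ℕ :=
  Module.finrank ℂ (LinearMap.range (M.F i (j - i)))

end ARep

/-- A morphism of representations of the equioriented type `A_n` quiver. -/
structure ARepHom {n : ℕ} (M N : ARep n) where
  φ : ∀ i, M.V i →ₗ[ℂ] N.V i
  comm : ∀ i, (φ (i + 1)).comp (M.f i) = (N.f i).comp (φ i)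

/-- Two representations are isomorphic if there is a morphism all of whose components
are bijective. -/
def ARepIso {n : ℕ} (M N : ARep n) : Prop :=
  ∃ h : ARepHom M N, ∀ i, Function.Bijective (h.φ i)

/-- The condition for the interval representation `U_{i,j}` to have a nonzero space at
vertex `k`. -/
def Ucond (n i j k : ℕ) : Prop := 1 ≤ k ∧ k ≤ n ∧ i ≤ k ∧ k ≤ j

instance (n i j k : ℕ) : Decidable (Ucond n i j k) := by unfold Ucond; infer_instance

/-- The space of `U_{i,j}` at vertex `k`, realized as a submodule of `ℂ`. -/
noncomputable def Uspace (n i j k : ℕ) : Submodule ℂ ℂ := if Ucond n i j k then ⊤ else ⊥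

/-- The indecomposable interval representation `U_{i,j}` (for `1 ≤ i ≤ j ≤ n`):
one-dimensional at the vertices `i ≤ k ≤ j`, zero elsewhere, with identity structure
maps inside the interval. -/
noncomputable def Urep (n i j : ℕ) : ARep n where
  V k := ↥(Uspace n i j k)
  f k := LinearMap.restrict
    (if Ucond n i j k ∧ Ucond n i j (k + 1) then (LinearMap.id : ℂ →ₗ[ℂ] ℂ) else 0)
    (p := Uspace n i j k) (q := Uspace n i j (k + 1))
    (by
      intro x hx
      by_cases h : Ucond n i j k ∧ Ucond n i j (k + 1)
      · rw [if_pos h]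
        simp [Uspace, if_pos h.2]
      · rw [if_neg h]
        simp)
  triv k hk := by
    have hbot : Uspace n i j k = ⊥ := by
      simp only [Uspace]; rw [if_neg]; unfold Ucond; omega
    have h0 := (Submodule.eq_bot_iff _).mp hbot
    exact ⟨fun a b => Subtype.ext ((h0 a.1 a.2).trans (h0 b.1 b.2).symm)⟩

/-- The componentwise direct sum of two representations. -/
noncomputable def ARep.dsum {n : ℕ} (M N : ARep n) : ARep n where
  V i := M.V i × N.V i
  f i := (M.f i).prodMap (N.f i)
  triv i hi := by
    haveI := M.triv i hi
    haveI := N.triv i hi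
    exact ⟨fun a b => Prod.ext (Subsingleton.elim _ _) (Subsingleton.elim _ _)⟩

/-- A representation is nonzero if some vector space is nonzero. -/
def ARep.Nonzero {n : ℕ} (M : ARep n) : Prop := ∃ i, ∃ v : M.V i, v ≠ 0

/-- The index set of segments `1 ≤ i ≤ j ≤ n`. -/
def SegIdx (n : ℕ) : Type :=
  {p : Fin (n + 1) × Fin (n + 1) // 1 ≤ p.1.1 ∧ p.1.1 ≤ p.2.1}

instance (n : ℕ) : Fintype (SegIdx n) := by unfold SegIdx; infer_instance

/-- The direct sum `⊕_{1 ≤ i ≤ j ≤ n} U_{i,j}^{⊕ m i j}`, taken componentwise. -/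
noncomputable def sumU (n : ℕ) (m : ℕ → ℕ → ℕ) : ARep n where
  V k := ∀ p : SegIdx n, Fin (m p.1.1.1 p.1.2.1) → (Urep n p.1.1.1 p.1.2.1).V k
  f k := LinearMap.pi fun p =>
    (((Urep n p.1.1.1 p.1.2.1).f k).compLeft (Fin (m p.1.1.1 p.1.2.1))).comp
      (LinearMap.proj p)
  triv k hk := by
    haveI := fun p : SegIdx n => (Urep n p.1.1.1 p.1.2.1).triv k hk
    exact ⟨fun a b => funext fun p => Subsingleton.elim _ _⟩

/-- The space of morphisms `Hom(M,N)` realized as a subspace of the product of the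
spaces of componentwise linear maps. -/
noncomputable def HomSubspace {n : ℕ} (M N : ARep n) :
    Submodule ℂ (∀ k, M.V k →ₗ[ℂ] N.V k) where
  carrier := {φ | ∀ k, (φ (k + 1)).comp (M.f k) = (N.f k).comp (φ k)}
  add_mem' := by
    intro a b ha hb k
    simp only [Pi.add_apply, LinearMap.add_comp, LinearMap.comp_add, ha k, hb k]
  zero_mem' := by
    intro k
    simp
  smul_mem' := by
    intro c a ha k
    simp only [Pi.smul_apply, LinearMap.smul_comp, LinearMap.comp_smul, ha k]

/-- The quotient of a representation by a family of subspaces stable under the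
structure maps. -/
noncomputable def ARep.quot {n : ℕ} (M : ARep n) (S : ∀ k, Submodule ℂ (M.V k))
    (h : ∀ k, S k ≤ (S (k + 1)).comap (M.f k)) : ARep n where
  V k := M.V k ⧸ S k
  f k := Submodule.mapQ (S k) (S (k + 1)) (M.f k) (h k)
  triv k hk := by
    haveI := M.triv k hk
    refine ⟨fun a b => ?_⟩
    obtain ⟨x, rfl⟩ := Submodule.Quotient.mk_surjective _ a
    obtain ⟨y, rfl⟩ := Submodule.Quotient.mk_surjective _ b
    exact congrArg _ (Subsingleton.elim x y)

/-- The quotient `M / ι(L)` of `M` by the image of a morphism `ι : L → M`. -/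
noncomputable def quotByHom {n : ℕ} {L M : ARep n} (ι : ARepHom L M) : ARep n :=
  M.quot (fun k => LinearMap.range (ι.φ k)) (by
    intro k x hx
    obtain ⟨y, rfl⟩ := hx
    rw [Submodule.mem_comap]
    exact ⟨L.f k y, LinearMap.congr_fun (ι.comm k) y⟩)

/-- The subrepresentation of `M` given by a family of subspaces stable under the
structure maps. -/
noncomputable def ARep.sub {n : ℕ} (M : ARep n) (N : ∀ i, Submodule ℂ (M.V i))
    (h : ∀ i, ∀ x ∈ N i, M.f i x ∈ N (i + 1)) : ARep n where
  V i := ↥(N i)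
  f i := (M.f i).restrict (h i)
  triv i hi := by
    haveI := M.triv i hi
    exact ⟨fun a b => Subtype.ext (Subsingleton.elim _ _)⟩

/-- The subquotient representation `P/S` of `M`, for families of subspaces
`S k ≤ P k` both stable under the structure maps. -/
noncomputable def ARep.subquot {n : ℕ} (M : ARep n) (P S : ∀ k, Submodule ℂ (M.V k))
    (hSP : ∀ k, S k ≤ P k)
    (hP : ∀ k, ∀ x ∈ P k, M.f k x ∈ P (k + 1))
    (hS : ∀ k, ∀ x ∈ S k, M.f k x ∈ S (k + 1)) : ARep n where
  V k := ↥(P k) ⧸ (S k).comap (P k).subtype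
  f k := Submodule.mapQ _ _ ((M.f k).restrict (hP k)) (by
    intro x hx
    rw [Submodule.mem_comap] at hx ⊢
    exact hS k x.1 hx)
  triv k hk := by
    haveI := M.triv k hk
    haveI : Subsingleton (↥(P k)) := ⟨fun a b => Subtype.ext (Subsingleton.elim _ _)⟩
    refine ⟨fun a b => ?_⟩
    obtain ⟨x, rfl⟩ := Submodule.Quotient.mk_surjective _ a
    obtain ⟨y, rfl⟩ := Submodule.Quotient.mk_surjective _ b
    exact congrArg _ (Subsingleton.elim x y)

/-- A `σ`-compatible `ε`-form on the underlying graded vector space of `M` making `M`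
an `ε`-representation: a nondegenerate bilinear form `B` on `M^0 = ⊕_i M_i` with
`B v w = ε B w v`, with `B (M_i) (M_j) = 0` unless `i + j = n + 1` (i.e. `j = σ(i)`),
and anti-compatible with the structure maps. -/
structure EpsForm (n : ℕ) (M : ARep n) (ε : ℂ) where
  B : (∀ i, M.V i) →ₗ[ℂ] (∀ i, M.V i) →ₗ[ℂ] ℂ
  nondeg : ∀ v, (∀ w, B v w = 0) → v = 0
  eps_symm : ∀ v w, B v w = ε * B w v
  graded : ∀ (i j : ℕ) (v : M.V i) (w : M.V j), i + j ≠ n + 1 →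
    B (Pi.single i v) (Pi.single j w) = 0
  compat : ∀ i, 1 ≤ i → i + 1 ≤ n → ∀ (v : M.V i) (w : M.V (n - i)),
    B (Pi.single (i + 1) (M.f i v)) (Pi.single (n - i) w)
      + B (Pi.single i v) (Pi.single (n - i + 1) (M.f (n - i) w)) = 0

/-- The orthogonal complement, at vertex `p`, of the image of a morphism `ι : L → M`
with respect to the form `E`. -/
noncomputable def perpAt {n : ℕ} {L M : ARep n} {ε : ℂ} (E : EpsForm n M ε)
    (ι : ARepHom L M) (p : ℕ) : Submodule ℂ (M.V p) where
  carrier := {y | ∀ (q : ℕ) (x : M.V q), x ∈ LinearMap.range (ι.φ q) →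
    E.B (Pi.single p y) (Pi.single q x) = 0}
  add_mem' := by
    intro a b ha hb q x hx
    rw [Pi.single_add, map_add, LinearMap.add_apply, ha q x hx, hb q x hx, add_zero]
  zero_mem' := by
    intro q x hx
    rw [Pi.single_zero, map_zero, LinearMap.zero_apply]
  smul_mem' := by
    intro c a ha q x hx
    rw [Pi.single_smul, map_smul, LinearMap.smul_apply, ha q x hx, smul_zero]


namespace ARepAux

section Lin

variable {V V' W W' : Type} [AddCommGroup V] [Module ℂ V] [FiniteDimensional ℂ V]
  [AddCommGroup V'] [Module ℂ V'] [FiniteDimensional ℂ V']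
  [AddCommGroup W] [Module ℂ W] [FiniteDimensional ℂ W]
  [AddCommGroup W'] [Module ℂ W'] [FiniteDimensional ℂ W']

theorem rank_nullity (f : V →ₗ[ℂ] W) (B : Submodule ℂ V) :
    finrank ℂ (B.map f) + finrank ℂ ↥(B ⊓ LinearMap.ker f) = finrank ℂ B := by
  have h := LinearMap.finrank_range_add_finrank_ker (f.domRestrict B)
  rw [LinearMap.range_domRestrict, LinearMap.ker_domRestrict,
    ← Submodule.finrank_map_subtype_eq, Submodule.map_comap_subtype] at h
  exact h

theorem finrank_map_inj (f : V →ₗ[ℂ] W) (B : Submodule ℂ V)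
    (h : ∀ x ∈ B, f x = 0 → x = 0) : finrank ℂ (B.map f) = finrank ℂ B := by
  have h1 := rank_nullity f B
  have h2 : B ⊓ LinearMap.ker f = ⊥ := by
    rw [Submodule.eq_bot_iff]
    rintro x ⟨hx, hk⟩
    exact h x hx hk
  rw [h2] at h1
  simpa using h1

/-- One-dimensional extension step. -/
theorem ext_step (f : V →ₗ[ℂ] W) (f' : V' →ₗ[ℂ] W') (ψ : W →ₗ[ℂ] W')
    (hψ : Function.Injective ψ) (B : Submodule ℂ V) (B' : Submodule ℂ V')
    (hB : finrank ℂ B = finrank ℂ B') (hfB : (B.map f).map ψ = B'.map f')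
    (A : Submodule ℂ V) (hAB : A < B) (φ : V →ₗ[ℂ] V')
    (hinj : ∀ x ∈ A, φ x = 0 → x = 0) (hcomm : ∀ x ∈ A, f' (φ x) = ψ (f x))
    (hmap : ∀ x ∈ A, φ x ∈ B') :
    ∃ (A1 : Submodule ℂ V) (φ1 : V →ₗ[ℂ] V'), A < A1 ∧ A1 ≤ B ∧ (∀ x ∈ A, φ1 x = φ x) ∧
      (∀ x ∈ A1, φ1 x = 0 → x = 0) ∧ (∀ x ∈ A1, f' (φ1 x) = ψ (f x)) ∧
      (∀ x ∈ A1, φ1 x ∈ B') := by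
  have key : ∃ b ∈ B, b ∉ A ∧ ∃ b' ∈ B', b' ∉ A.map φ ∧ f' b' = ψ (f b) := by
    by_cases hk : B ⊓ LinearMap.ker f ≤ A
    · obtain ⟨b, hb, hbA⟩ := SetLike.exists_of_lt hAB
      have : ψ (f b) ∈ B'.map f' := by
        rw [← hfB]
        exact ⟨f b, ⟨b, hb, rfl⟩, rfl⟩
      obtain ⟨b', hb', he⟩ := this
      refine ⟨b, hb, hbA, b', hb', ?_, he⟩
      rintro ⟨a, ha, rfl⟩
      rw [hcomm a ha] at he
      have h0 : b - a ∈ B ⊓ LinearMap.ker f := by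
        refine ⟨B.sub_mem hb (hAB.le ha), ?_⟩
        rw [SetLike.mem_coe, LinearMap.mem_ker, map_sub, hψ he, sub_self]
      have := A.add_mem (hk h0) ha
      rw [sub_add_cancel] at this
      exact hbA this
    · obtain ⟨b, hb, hbA⟩ := SetLike.not_le_iff_exists.mp hk
      have hlt : A ⊓ LinearMap.ker f < B ⊓ LinearMap.ker f := by
        refine lt_of_le_of_ne (inf_le_inf_right _ hAB.le) ?_
        intro h
        rw [← h] at hb
        exact hbA hb.1
      have hlt' := Submodule.finrank_lt_finrank_of_lt hlt
      have e1 := rank_nullity f A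
      have e2 := rank_nullity f B
      have e3 := rank_nullity f' B'
      have e4 := rank_nullity f' (A.map φ)
      have e5 := finrank_map_inj φ A hinj
      have hfA : (A.map φ).map f' = (A.map f).map ψ := by
        ext y
        simp only [Submodule.mem_map, exists_exists_and_eq_and]
        constructor
        · rintro ⟨a, ha, rfl⟩; exact ⟨a, ha, (hcomm a ha).symm⟩
        · rintro ⟨a, ha, rfl⟩; exact ⟨a, ha, hcomm a ha⟩
      have hz : ∀ x, ψ x = 0 → x = 0 := fun x hx => hψ (by rw [hx, map_zero])
      rw [hfA, finrank_map_inj ψ _ (fun x _ => hz x)] at e4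
      rw [← hfB, finrank_map_inj ψ _ (fun x _ => hz x)] at e3
      have hn : ¬ (B' ⊓ LinearMap.ker f' ≤ A.map φ) := by
        intro h
        have := Submodule.finrank_mono (le_inf h inf_le_right)
        omega
      obtain ⟨b', hb', hbA'⟩ := SetLike.not_le_iff_exists.mp hn
      refine ⟨b, hb.1, hbA, b', hb'.1, hbA', ?_⟩
      rw [LinearMap.mem_ker.mp hb.2, LinearMap.mem_ker.mp hb'.2, map_zero]
  obtain ⟨b, hb, hbA, b', hb', hbA', he⟩ := key
  obtain ⟨l0, hl0, hlA⟩ := Submodule.exists_le_ker_of_notMem hbA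
  have hl : ∀ x ∈ A, l0 x = 0 := fun x hx => hlA hx
  let φ1 : V →ₗ[ℂ] V' := φ + ((l0 b)⁻¹ • l0).smulRight (b' - φ b)
  have h1 : ∀ x ∈ A, φ1 x = φ x := by
    intro x hx
    simp [φ1, hl x hx]
  have h2 : φ1 b = b' := by
    simp [φ1, inv_mul_cancel₀ hl0]
  have hmem : ∀ x ∈ A ⊔ ℂ ∙ b, ∃ a ∈ A, ∃ c : ℂ, x = a + c • b := by
    intro x hx
    obtain ⟨a, ha, z, hz, rfl⟩ := Submodule.mem_sup.mp hx
    obtain ⟨c, rfl⟩ := Submodule.mem_span_singleton.mp hz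
    exact ⟨a, ha, c, rfl⟩
  refine ⟨A ⊔ ℂ ∙ b, φ1, ?_, ?_, h1, ?_, ?_, ?_⟩
  · refine lt_of_le_of_ne le_sup_left ?_
    intro h
    apply hbA
    rw [h]
    exact Submodule.mem_sup_right (Submodule.mem_span_singleton_self b)
  · refine sup_le hAB.le ?_
    rw [Submodule.span_singleton_le_iff_mem]
    exact hb
  · intro x hx h0
    obtain ⟨a, ha, c, rfl⟩ := hmem x hx
    rw [map_add, map_smul, h1 a ha, h2] at h0
    by_cases hc : c = 0
    · subst hc
      simp only [zero_smul, add_zero] at h0 ⊢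
      exact hinj a ha h0
    · exfalso
      apply hbA'
      refine ⟨-(c⁻¹ • a), A.neg_mem (A.smul_mem _ ha), ?_⟩
      rw [map_neg, map_smul, eq_neg_of_add_eq_zero_left h0, smul_neg, neg_neg, smul_smul,
        inv_mul_cancel₀ hc, one_smul]
  · intro x hx
    obtain ⟨a, ha, c, rfl⟩ := hmem x hx
    simp only [map_add, map_smul, h1 a ha, h2, hcomm a ha, he]
  · intro x hx
    obtain ⟨a, ha, c, rfl⟩ := hmem x hx
    rw [map_add, map_smul, h1 a ha, h2]
    exact B'.add_mem (hmap a ha) (B'.smul_mem _ hb')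

theorem ext_full (f : V →ₗ[ℂ] W) (f' : V' →ₗ[ℂ] W') (ψ : W →ₗ[ℂ] W')
    (hψ : Function.Injective ψ) (B : Submodule ℂ V) (B' : Submodule ℂ V')
    (hB : finrank ℂ B = finrank ℂ B') (hfB : (B.map f).map ψ = B'.map f') (d : ℕ) :
    ∀ (A : Submodule ℂ V) (_ : finrank ℂ B ≤ finrank ℂ A + d) (_ : A ≤ B) (φ : V →ₗ[ℂ] V')
    (_ : ∀ x ∈ A, φ x = 0 → x = 0) (_ : ∀ x ∈ A, f' (φ x) = ψ (f x))
    (_ : ∀ x ∈ A, φ x ∈ B'),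
    ∃ (φ1 : V →ₗ[ℂ] V'), (∀ x ∈ A, φ1 x = φ x) ∧
      (∀ x ∈ B, φ1 x = 0 → x = 0) ∧ (∀ x ∈ B, f' (φ1 x) = ψ (f x)) ∧ B.map φ1 = B' := by
  induction d with
  | zero =>
    intro A hd hAB φ hinj hcomm hmap
    have hE : A = B := Submodule.eq_of_le_of_finrank_le hAB (by omega)
    subst hE
    refine ⟨φ, fun _ _ => rfl, hinj, hcomm, ?_⟩
    apply Submodule.eq_of_le_of_finrank_le
    · rintro _ ⟨x, hx, rfl⟩; exact hmap x hx
    · rw [finrank_map_inj φ A hinj, hB]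
  | succ d ih =>
    intro A hd hAB φ hinj hcomm hmap
    rcases hAB.lt_or_eq with hlt | hE
    · obtain ⟨A1, φ1, hA1, hA1B, hag, i1, c1, m1⟩ :=
        ext_step f f' ψ hψ B B' hB hfB A hlt φ hinj hcomm hmap
      have := Submodule.finrank_lt_finrank_of_lt hA1
      obtain ⟨φ2, ag2, r2⟩ := ih A1 (by omega) hA1B φ1 i1 c1 m1
      exact ⟨φ2, fun x hx => (ag2 x (hA1.le hx)).trans (hag x hx), r2⟩
    · exact ih A (by rw [hE]; omega) hAB φ hinj hcomm hmap

theorem flag_lift (f : V →ₗ[ℂ] W) (f' : V' →ₗ[ℂ] W') (ψ : W →ₗ[ℂ] W')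
    (hψ : Function.Injective ψ) (I : ℕ → Submodule ℂ V) (I' : ℕ → Submodule ℂ V')
    (hI : Monotone I) (hI' : Monotone I')
    (hB : ∀ i, finrank ℂ (I i) = finrank ℂ (I' i))
    (hfB : ∀ i, ((I i).map f).map ψ = (I' i).map f') (m : ℕ) :
    ∃ φ : V →ₗ[ℂ] V', (∀ x ∈ I m, φ x = 0 → x = 0) ∧ (∀ x ∈ I m, f' (φ x) = ψ (f x)) ∧
      ∀ j ≤ m, (I j).map φ = I' j := by
  induction m with
  | zero =>
    obtain ⟨φ, -, h1, h2, h3⟩ := ext_full f f' ψ hψ (I 0) (I' 0) (hB 0) (hfB 0)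
      (finrank ℂ (I 0)) ⊥ (by simp) bot_le 0 (by simp) (by simp) (by simp)
    refine ⟨φ, h1, h2, ?_⟩
    intro j hj
    obtain rfl : j = 0 := by omega
    exact h3
  | succ m ih =>
    obtain ⟨φ, h1, h2, h3⟩ := ih
    obtain ⟨φ1, ag, k1, k2, k3⟩ := ext_full f f' ψ hψ (I (m+1)) (I' (m+1)) (hB _) (hfB _)
      (finrank ℂ (I (m+1))) (I m) (by omega) (hI (by omega)) φ h1 h2 (by
        intro x hx
        apply hI' (Nat.le_succ m)
        rw [← h3 m le_rfl]
        exact ⟨x, hx, rfl⟩)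
    refine ⟨φ1, k1, k2, ?_⟩
    intro j hj
    rcases Nat.lt_or_ge j (m+1) with h | h
    · rw [← h3 j (by omega)]
      ext y
      simp only [Submodule.mem_map]
      have hle : I j ≤ I m := hI (by omega)
      constructor
      · rintro ⟨x, hx, rfl⟩; exact ⟨x, hx, (ag x (hle hx)).symm⟩
      · rintro ⟨x, hx, rfl⟩; exact ⟨x, hx, ag x (hle hx)⟩
    · obtain rfl : j = m + 1 := by omega
      exact k3

end Lin

/-- The image flag at vertex `k`. -/
noncomputable def Im {n : ℕ} (M : ARep n) (i : ℕ) : (k : ℕ) → Submodule ℂ (M.V k)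
  | 0 => ⊤
  | (k + 1) => if k + 1 ≤ i then ⊤ else (Im M i k).map (M.f k)

theorem Im_top {n : ℕ} (M : ARep n) {i k : ℕ} (h : k ≤ i) : Im M i k = ⊤ := by
  cases k with
  | zero => rfl
  | succ k => simp [Im, h]

theorem Im_succ {n : ℕ} (M : ARep n) {i k : ℕ} (h : i ≤ k) :
    Im M i (k + 1) = (Im M i k).map (M.f k) := by
  simp [Im, show ¬ (k + 1 ≤ i) by omega]

theorem Im_mono {n : ℕ} (M : ARep n) (k : ℕ) : Monotone (fun i => Im M i k) := by
  induction k with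
  | zero => intro i j _; exact le_rfl
  | succ k ih =>
    intro i j hij
    by_cases h : k + 1 ≤ j
    · simp only [Im_top M h]; exact le_top
    · simp only [Im_succ M (show i ≤ k by omega), Im_succ M (show j ≤ k by omega)]
      exact Submodule.map_mono (ih hij)

theorem Im_eq {n : ℕ} (M : ARep n) (i k : ℕ) : Im M i (i + k) = LinearMap.range (M.F i k) := by
  induction k with
  | zero =>
    rw [show M.F i 0 = LinearMap.id from rfl, LinearMap.range_id]
    exact Im_top M le_rfl
  | succ k ih =>
    rw [show M.F i (k+1) = (M.f (i + k)).comp (M.F i k) from rfl, LinearMap.range_comp, ← ih]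
    exact Im_succ M (Nat.le_add_right i k)

theorem finrank_Im {n : ℕ} (M : ARep n) {i k : ℕ} (h : i ≤ k) :
    finrank ℂ (Im M i k) = M.r i k := by
  obtain ⟨d, rfl⟩ := Nat.exists_eq_add_of_le h
  rw [Im_eq, ARep.r, Nat.add_sub_cancel_left]

theorem backward {n : ℕ} (M N : ARep n)
    (H : ∀ i j, 1 ≤ i → i ≤ j → j ≤ n → M.r i j = N.r i j) : ARepIso M N := by
  have hfr : ∀ k i, finrank ℂ (Im M i k) = finrank ℂ (Im N i k) := by
    have base : ∀ k i, i ≤ k → finrank ℂ (Im M i k) = finrank ℂ (Im N i k) := by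
      intro k i hik
      rcases Nat.lt_or_ge n k with h | h
      · haveI := M.triv k (Or.inr h)
        haveI := N.triv k (Or.inr h)
        rw [finrank_zero_of_subsingleton, finrank_zero_of_subsingleton]
      · rcases Nat.eq_zero_or_pos i with rfl | hi
        · haveI := M.triv 0 (Or.inl rfl)
          haveI := N.triv 0 (Or.inl rfl)
          obtain ⟨d, rfl⟩ := Nat.exists_eq_add_of_le hik
          have z : ∀ L : ARep n, finrank ℂ (Im L 0 (0 + d)) = 0 := by
            intro L
            haveI := L.triv 0 (Or.inl rfl)
            rw [Im_eq, show L.F 0 d = 0 from LinearMap.ext fun x => by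
              rw [Subsingleton.elim x 0, map_zero, map_zero], LinearMap.range_zero]
            exact finrank_bot ℂ _
          rw [z, z]
        · rw [finrank_Im M hik, finrank_Im N hik]
          exact H i k hi hik h
    intro k i
    rcases Nat.le_total i k with h | h
    · exact base k i h
    · have := base k k le_rfl
      rwa [Im_top M h, Im_top N h, ← Im_top M le_rfl, ← Im_top N le_rfl]
  have main : ∀ m, m ≤ n + 1 → ∃ φ : ∀ i, M.V i →ₗ[ℂ] N.V i,
      (∀ i, n + 1 - m ≤ i → (φ (i + 1)).comp (M.f i) = (N.f i).comp (φ i)) ∧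
      (∀ i, n + 1 - m ≤ i → Function.Bijective (φ i)) ∧
      (∀ i, (Im M i (n + 1 - m)).map (φ (n + 1 - m)) = Im N i (n + 1 - m)) := by
    intro m
    induction m with
    | zero =>
      intro _
      refine ⟨fun _ => 0, fun i _ => by simp, ?_, ?_⟩
      · intro i hi
        haveI := M.triv i (Or.inr (by omega))
        haveI := N.triv i (Or.inr (by omega))
        exact ⟨fun _ _ _ => Subsingleton.elim _ _, fun y => ⟨0, Subsingleton.elim _ _⟩⟩
      · intro i
        haveI := N.triv (n + 1 - 0) (Or.inr (by omega))
        exact Subsingleton.elim _ _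
    | succ m ih =>
      intro hm
      obtain ⟨φ, hc, hb, hf⟩ := ih (by omega)
      obtain ⟨k, hk⟩ : ∃ k, k = n + 1 - (m + 1) := ⟨_, rfl⟩
      have hk1 : n + 1 - m = k + 1 := by omega
      rw [hk1] at hc hb hf
      rw [← hk]
      have hfB : ∀ i, ((Im M i k).map (M.f k)).map (φ (k+1)) = (Im N i k).map (N.f k) := by
        intro i
        rcases Nat.le_total i k with h | h
        · rw [← Im_succ M h, ← Im_succ N h, hf]
        · have e := hf k
          rw [Im_succ M le_rfl, Im_succ N le_rfl, Im_top M le_rfl, Im_top N le_rfl] at e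
          rw [Im_top M h, Im_top N h, e]
      obtain ⟨χ, x1, x2, x3⟩ := flag_lift (M.f k) (N.f k) (φ (k+1)) (hb (k+1) le_rfl).1
        (fun i => Im M i k) (fun i => Im N i k) (Im_mono M k) (Im_mono N k) (hfr k) hfB k
      simp only [Im_top M (le_refl k), Submodule.mem_top, forall_const] at x1 x2
      have x4 := x3 k le_rfl
      simp only [Im_top M (le_refl k), Im_top N (le_refl k), Submodule.map_top] at x4
      have hbij : Function.Bijective χ :=
        ⟨(injective_iff_map_eq_zero χ).mpr x1, LinearMap.range_eq_top.mp x4⟩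
      have hne : ∀ i, k + 1 ≤ i → Function.update φ k χ i = φ i := fun i hi =>
        Function.update_of_ne (by omega) _ _
      refine ⟨Function.update φ k χ, ?_, ?_, ?_⟩
      · intro i hi
        rcases hi.eq_or_lt with rfl | h
        · rw [hne (k+1) le_rfl, Function.update_self]
          ext x
          exact (x2 x).symm
        · rw [hne i h, hne (i+1) (by omega)]
          exact hc i h
      · intro i hi
        rcases hi.eq_or_lt with rfl | h
        · rw [Function.update_self]; exact hbij
        · rw [hne i h]; exact hb i h
      · intro i
        rw [Function.update_self]
        rcases Nat.le_total i k with h | h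
        · exact x3 i h
        · rw [Im_top M h, Im_top N h, Submodule.map_top, x4]
  obtain ⟨φ, hc, hb, -⟩ := main (n + 1) le_rfl
  exact ⟨⟨φ, fun i => hc i (by omega)⟩, fun i => hb i (by omega)⟩

theorem forward {n : ℕ} (M N : ARep n) (h : ARepIso M N) (i j : ℕ) : M.r i j = N.r i j := by
  obtain ⟨h, hb⟩ := h
  have hF : ∀ d, (h.φ (i + d)).comp (M.F i d) = (N.F i d).comp (h.φ i) := by
    intro d
    induction d with
    | zero => ext x; rfl
    | succ d ih =>
      rw [show M.F i (d+1) = (M.f (i + d)).comp (M.F i d) from rfl,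
        show N.F i (d+1) = (N.f (i + d)).comp (N.F i d) from rfl, LinearMap.comp_assoc, ← ih,
        ← LinearMap.comp_assoc, ← LinearMap.comp_assoc, ← h.comm (i + d)]
      rfl
  have e : (LinearMap.range (M.F i (j - i))).map (h.φ (i + (j - i)))
      = LinearMap.range (N.F i (j - i)) := by
    rw [← LinearMap.range_comp, hF, LinearMap.range_comp,
      LinearMap.range_eq_top.mpr (hb i).2, Submodule.map_top]
  rw [ARep.r, ARep.r, ← e]
  exact (finrank_map_inj _ _ fun x _ hx => (hb _).1 (by rw [hx, map_zero])).symm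

end ARepAux

theorem iso_iff_rank_sequences_eq (n : ℕ) (hn : 1 ≤ n) (M N : ARep n) :
    ARepIso M N ↔ ∀ i j, 1 ≤ i → i ≤ j → j ≤ n → M.r i j = N.r i j := by
  exact ⟨fun h i j _ _ _ => ARepAux.forward M N h i j, ARepAux.backward M N⟩
end

section
/- Let M be a representation of the equioriented type A_n quiver over ℂ and fix ε ∈ {+1,−1}. Then the following are equivalent: (a) there exist a graded finite-dimensional ℂ-vector space N^0 = N_1 ⊕ ⋯ ⊕ N_n with a σ-compatible ε-form and an ε-representation N with underlying graded space N^0 such that N is isomorphic to M as a representation; (b) r^M_{i,j} = r^M_{σ(j),σ(i)} for all 1 ≤ i ≤ j ≤ n, and, in case of a split type (n odd with ε = −1, or n even with ε = +1), r^M_{i,σ(i)} is even for every i with i ≤ σ(i). -/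
open Module

/-! ### Generalities on the composite maps -/

theorem skew_rank_even {V : Type} [AddCommGroup V] [Module ℂ V] [FiniteDimensional ℂ V]
    (b : V →ₗ[ℂ] V →ₗ[ℂ] ℂ) (hb : ∀ v w, b v w = - b w v) :
    Even (finrank ℂ (LinearMap.range b)) := by
  obtain ⟨W, hW⟩ := Submodule.exists_isCompl (LinearMap.ker b)
  have h1 := Submodule.finrank_add_eq_of_isCompl hW
  have h2 := LinearMap.finrank_range_add_finrank_ker b
  have h3 : finrank ℂ (LinearMap.range b) = finrank ℂ W := by omega
  rw [h3]
  by_contra hodd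
  rw [Nat.not_even_iff_odd] at hodd
  let e := Module.finBasis ℂ W
  let A : Matrix (Fin (finrank ℂ W)) (Fin (finrank ℂ W)) ℂ := fun i j => b (e i) (e j)
  have hA : A.transpose = -A := by
    ext i j
    exact hb _ _
  have hdet : A.det = 0 := by
    have h4 : A.det = (-A).det := by rw [← hA, Matrix.det_transpose]
    rw [Matrix.det_neg, Fintype.card_fin, hodd.neg_one_pow] at h4
    have : (2 : ℂ) * A.det = 0 := by linear_combination h4
    simpa using this
  obtain ⟨v, hv0, hv⟩ := Matrix.exists_vecMul_eq_zero_iff.mpr hdet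
  apply hv0
  let x : W := ∑ i, v i • e i
  have hx1 : ∀ j, b (x : V) (e j) = 0 := by
    intro j
    have := congrFun hv j
    simp only [Matrix.vecMul, dotProduct, Pi.zero_apply, A] at this
    simpa [x, LinearMap.sum_apply] using this
  have hx2 : ∀ w : W, b (x : V) w = 0 := by
    have h0 : (b (x : V)).comp W.subtype = 0 := e.ext fun j => hx1 j
    exact fun w => LinearMap.congr_fun h0 w
  have hx3 : (x : V) ∈ LinearMap.ker b := by
    rw [LinearMap.mem_ker]
    ext y
    have hy : y ∈ LinearMap.ker b ⊔ W := by rw [hW.sup_eq_top]; trivial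
    obtain ⟨p, hp, q, hq, rfl⟩ := Submodule.mem_sup.mp hy
    rw [LinearMap.mem_ker] at hp
    rw [map_add, hx2 ⟨q, hq⟩, hb, hp]
    simp
  have hx4 : (x : V) = 0 := by
    have := hW.disjoint
    rw [Submodule.disjoint_def] at this
    exact this _ hx3 x.2
  have hx5 : x = 0 := by ext; exact hx4
  have hli := Fintype.linearIndependent_iff.mp e.linearIndependent v hx5
  ext i
  exact hli i

namespace ARep

theorem single_f_congr {n : ℕ} (M : ARep n) {a b : ℕ} (hab : a = b) (x : M.V a) (y : M.V b)
    (h : (Pi.single a x : ∀ i, M.V i) = Pi.single b y) :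
    (Pi.single (a + 1) (M.f a x) : ∀ i, M.V i) = Pi.single (b + 1) (M.f b y) := by
  subst hab
  rw [Pi.single_injective _ h]

theorem single_shift {n : ℕ} (M : ARep n) (p : ℕ) (w : M.V p) (k : ℕ) :
    (Pi.single (p + 1 + k) (M.F (p + 1) k (M.f p w)) : ∀ i, M.V i)
      = Pi.single (p + (k + 1)) (M.F p (k + 1) w) := by
  induction k with
  | zero => rfl
  | succ k ih => exact M.single_f_congr (show p + 1 + k = p + (k + 1) by omega) _ _ ih

theorem ker_shift {n : ℕ} (M : ARep n) (p k : ℕ) :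
    LinearMap.ker ((M.F (p + 1) k).comp (M.f p)) = LinearMap.ker (M.F p (k + 1)) := by
  ext w
  rw [LinearMap.mem_ker, LinearMap.mem_ker, LinearMap.comp_apply]
  have h := M.single_shift p w k
  rw [← Pi.single_eq_zero_iff (i := p + 1 + k), h, Pi.single_eq_zero_iff]

/-- rank of the `l`-step map starting at `i` -/
noncomputable def rho {n : ℕ} (M : ARep n) (i l : ℕ) : ℕ :=
  finrank ℂ (LinearMap.range (M.F i l))

theorem r_eq_rho {n : ℕ} (M : ARep n) (i l : ℕ) : M.r i (i + l) = M.rho i l := by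
  unfold r rho
  rw [Nat.add_sub_cancel_left]

theorem rho_zero_left {n : ℕ} (M : ARep n) (l : ℕ) : M.rho 0 l = 0 := by
  have : Subsingleton (M.V 0) := M.triv 0 (Or.inl rfl)
  unfold rho
  have : M.F 0 l = 0 := by
    ext x
    rw [Subsingleton.elim x 0]; simp
  rw [this]; simp

theorem rho_big {n : ℕ} (M : ARep n) (i l : ℕ) (h : n < i + l) : M.rho i l = 0 := by
  have : Subsingleton (M.V (i + l)) := M.triv _ (Or.inr h)
  unfold rho
  have : M.F i l = 0 := by
    ext x
    exact Subsingleton.elim _ _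
  rw [this]; simp

theorem rho_zero_right {n : ℕ} (M : ARep n) (i : ℕ) : M.rho i 0 = finrank ℂ (M.V i) := by
  unfold rho
  show finrank ℂ (LinearMap.range (LinearMap.id : M.V i →ₗ[ℂ] M.V i)) = _
  rw [LinearMap.range_id, finrank_top]

theorem rho_add_ker {n : ℕ} (M : ARep n) (i l : ℕ) :
    M.rho i l + finrank ℂ (LinearMap.ker (M.F i l)) = finrank ℂ (M.V i) :=
  LinearMap.finrank_range_add_finrank_ker _

end ARep

theorem rho_iso {n : ℕ} {N M : ARep n} (h : ARepIso N M) (i l : ℕ) : N.rho i l = M.rho i l := by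
  obtain ⟨φ, hφ⟩ := h
  have hc : ∀ l, (φ.φ (i + l)).comp (N.F i l) = (M.F i l).comp (φ.φ i) := by
    intro l
    induction l with
    | zero => rfl
    | succ l ih =>
      show (φ.φ (i + l + 1)).comp ((N.f (i + l)).comp (N.F i l))
        = ((M.f (i + l)).comp (M.F i l)).comp (φ.φ i)
      rw [← LinearMap.comp_assoc, φ.comm, LinearMap.comp_assoc, ih, LinearMap.comp_assoc]
  have h1 : LinearMap.range (M.F i l) = (LinearMap.range (N.F i l)).map (φ.φ (i + l)) := by
    rw [← LinearMap.range_comp, hc, LinearMap.range_comp_of_range_eq_top]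
    exact LinearMap.range_eq_top.mpr (hφ i).2
  unfold ARep.rho
  rw [h1]
  exact (LinearEquiv.finrank_eq (Submodule.equivMapOfInjective _ (hφ (i+l)).1 _))

/-! ### Forward direction -/

section forward
variable {n : ℕ} {N : ARep n} {ε : ℂ} (E : EpsForm n N ε)

theorem eps_adj (k : ℕ) : ∀ (i p : ℕ), 1 ≤ i → 1 ≤ p → i + k + p = n + 1 →
    ∀ (v : N.V i) (w : N.V p),
    E.B (Pi.single (i + k) (N.F i k v)) (Pi.single p w)
      = (-1) ^ k * E.B (Pi.single i v) (Pi.single (p + k) (N.F p k w)) := by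
  induction k with
  | zero => intro i p _ _ _ v w; simp [ARep.F]
  | succ k ih =>
    intro i p hi hp h v w
    obtain rfl : p = n - (i + k) := by omega
    have h1 := E.compat (i + k) (by omega) (by omega) (N.F i k v) w
    have h2 := ih i (n - (i + k) + 1) hi (by omega) (by omega) v (N.f _ w)
    rw [N.single_shift] at h2
    rw [h2] at h1
    have h3 : E.B (Pi.single (i + (k + 1)) (N.F i (k + 1) v)) (Pi.single (n - (i + k)) w)
      = E.B (Pi.single (i + k + 1) (N.f (i + k) (N.F i k v))) (Pi.single (n - (i + k)) w) := rfl
    rw [h3, pow_succ]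
    linear_combination h1

theorem pi_decomp (w : ∀ i, N.V i) : w = ∑ q ∈ Finset.range (n + 1), Pi.single q (w q) := by
  funext j
  rw [Finset.sum_apply]
  by_cases hj : j ∈ Finset.range (n + 1)
  · rw [Finset.sum_eq_single_of_mem j hj]
    · simp
    · intro b _ hb
      exact Pi.single_eq_of_ne (Ne.symm hb) _
  · have : Subsingleton (N.V j) := N.triv j (Or.inr (by simpa using hj))
    exact Subsingleton.elim _ _

/-- pairing between `V j` and `V p` -/
noncomputable def pairing (j p : ℕ) : N.V j →ₗ[ℂ] N.V p →ₗ[ℂ] ℂ :=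
  LinearMap.compl₁₂ E.B (LinearMap.single ℂ N.V j) (LinearMap.single ℂ N.V p)

theorem pairing_apply (j p : ℕ) (v : N.V j) (w : N.V p) :
    pairing E j p v w = E.B (Pi.single j v) (Pi.single p w) := rfl

theorem pairing_inj (j p : ℕ) (h : j + p = n + 1) : Function.Injective (pairing E j p) := by
  rw [injective_iff_map_eq_zero]
  intro v hv
  have h0 : (Pi.single j v : ∀ i, N.V i) = 0 := by
    apply E.nondeg
    intro w
    rw [pi_decomp w, map_sum]
    apply Finset.sum_eq_zero
    intro q _
    by_cases hq : q = p
    · subst hq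
      rw [← pairing_apply, hv]; rfl
    · exact E.graded _ _ _ _ (by omega)
  exact Pi.single_eq_zero_iff.mp h0

theorem rank_pairing (i k p : ℕ) (h : i + k + p = n + 1) :
    finrank ℂ (LinearMap.range ((pairing E (i + k) p).comp (N.F i k))) = N.rho i k := by
  rw [LinearMap.range_comp]
  exact (LinearEquiv.finrank_eq
    (Submodule.equivMapOfInjective _ (pairing_inj E (i + k) p h) _)).symm

theorem rank_flip {V W : Type} [AddCommGroup V] [Module ℂ V] [FiniteDimensional ℂ V]
    [AddCommGroup W] [Module ℂ W] [FiniteDimensional ℂ W] (b : V →ₗ[ℂ] W →ₗ[ℂ] ℂ) :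
    finrank ℂ (LinearMap.range b.flip) = finrank ℂ (LinearMap.range b) := by
  have h : b.flip = b.dualMap.comp (Module.evalEquiv ℂ W).toLinearMap := by
    ext w v
    rfl
  rw [h, LinearMap.range_comp_of_range_eq_top _ (LinearEquiv.range _),
    LinearMap.finrank_range_dualMap_eq_finrank_range]

theorem rho_symm (E : EpsForm n N ε) (hε : ε ≠ 0) (i k p : ℕ) (hi : 1 ≤ i) (hp : 1 ≤ p) (h : i + k + p = n + 1) :
    N.rho i k = N.rho p k := by
  rw [← rank_pairing E i k p h, ← rank_pairing E p k i (by omega), ← rank_flip]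
  have h1 : ((pairing E (i + k) p).comp (N.F i k)).flip
      = ((-1) ^ k * ε) • ((pairing E (p + k) i).comp (N.F p k)) := by
    ext w v
    simp only [LinearMap.flip_apply, LinearMap.comp_apply, LinearMap.smul_apply, pairing_apply,
      smul_eq_mul]
    rw [eps_adj E k i p hi hp h, E.eps_symm]
    ring
  rw [h1, LinearMap.range_smul]
  exact mul_ne_zero (pow_ne_zero _ (by norm_num)) hε

theorem rho_even (E : EpsForm n N ε) (i k : ℕ) (hi : 1 ≤ i) (h : i + k + i = n + 1) (hs : (-1) ^ k * ε = -1) :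
    Even (N.rho i k) := by
  rw [← rank_pairing E i k i h]
  apply skew_rank_even
  intro v w
  simp only [LinearMap.comp_apply, pairing_apply]
  rw [eps_adj E k i i hi hi h, E.eps_symm]
  linear_combination (E.B (Pi.single (i + k) (N.F i k w)) (Pi.single i v)) * hs

end forward

/-! ### The model representation attached to multiplicities -/

abbrev TIdx : Type := Σ _ : ℕ, Σ _ : ℕ, ℕ

/-- the copies of intervals `[a+1, a+1+l]` containing the vertex `k` -/
def NS (n : ℕ) (mm : ℕ → ℕ → ℕ) (k : ℕ) : Finset TIdx :=
  (Finset.range k).sigma fun a =>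
    (Finset.Ico (k - 1 - a) (n - a)).sigma fun l => Finset.range (mm a l)

/-- all copies of intervals -/
def NT (n : ℕ) (mm : ℕ → ℕ → ℕ) : Finset TIdx :=
  (Finset.range n).sigma fun a =>
    (Finset.range (n - a)).sigma fun l => Finset.range (mm a l)

theorem mem_NS {n : ℕ} {mm : ℕ → ℕ → ℕ} {k : ℕ} {x : TIdx} : x ∈ NS n mm k ↔
    x.1 < k ∧ k ≤ x.1 + x.2.1 + 1 ∧ x.1 + x.2.1 < n ∧ x.2.2 < mm x.1 x.2.1 := by
  simp only [NS, Finset.mem_sigma, Finset.mem_range, Finset.mem_Ico]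
  omega

theorem mem_NT {n : ℕ} {mm : ℕ → ℕ → ℕ} {x : TIdx} : x ∈ NT n mm ↔
    x.1 + x.2.1 < n ∧ x.2.2 < mm x.1 x.2.1 := by
  simp only [NT, Finset.mem_sigma, Finset.mem_range]
  omega

theorem NS_sub_NT {n : ℕ} {mm : ℕ → ℕ → ℕ} {k : ℕ} {x : TIdx} (h : x ∈ NS n mm k) :
    x ∈ NT n mm := by
  rw [mem_NS] at h; rw [mem_NT]; exact h.2.2

/-- coordinate functional, extended by zero -/
noncomputable def extL (n : ℕ) (mm : ℕ → ℕ → ℕ) (k : ℕ) (x : TIdx) :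
    ({y // y ∈ NS n mm k} → ℂ) →ₗ[ℂ] ℂ :=
  if h : x ∈ NS n mm k then LinearMap.proj ⟨x, h⟩ else 0

theorem extL_pos {n : ℕ} {mm : ℕ → ℕ → ℕ} {k : ℕ} {x : TIdx} (h : x ∈ NS n mm k)
    (v : {y // y ∈ NS n mm k} → ℂ) : extL n mm k x v = v ⟨x, h⟩ := by
  simp [extL, h]

theorem extL_neg {n : ℕ} {mm : ℕ → ℕ → ℕ} {k : ℕ} {x : TIdx} (h : x ∉ NS n mm k)
    (v : {y // y ∈ NS n mm k} → ℂ) : extL n mm k x v = 0 := by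
  simp [extL, h]

noncomputable def Nrep (n : ℕ) (mm : ℕ → ℕ → ℕ) : ARep n where
  V k := {y // y ∈ NS n mm k} → ℂ
  f k := LinearMap.pi fun x => extL n mm k x.1
  triv k hk := by
    have : IsEmpty {y // y ∈ NS n mm k} := by
      refine ⟨fun y => ?_⟩
      have := mem_NS.mp y.2
      omega
    infer_instance

/-- coordinate functionals on the model representation -/
noncomputable def cf (n : ℕ) (mm : ℕ → ℕ → ℕ) (k : ℕ) (x : TIdx) :
    (Nrep n mm).V k →ₗ[ℂ] ℂ := extL n mm k x

theorem cf_neg {n : ℕ} {mm : ℕ → ℕ → ℕ} {k : ℕ} {x : TIdx} (h : x ∉ NS n mm k)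
    (v : (Nrep n mm).V k) : cf n mm k x v = 0 := extL_neg h v

theorem cf_f_pos {n : ℕ} {mm : ℕ → ℕ → ℕ} {k : ℕ} {x : TIdx} (h : x ∈ NS n mm (k + 1))
    (v : (Nrep n mm).V k) : cf n mm (k + 1) x ((Nrep n mm).f k v) = cf n mm k x v :=
  extL_pos h _

theorem cf_ext {n : ℕ} {mm : ℕ → ℕ → ℕ} {k : ℕ} (v : (Nrep n mm).V k)
    (h : ∀ x ∈ NS n mm k, cf n mm k x v = 0) : v = 0 := by
  funext x
  exact (extL_pos x.2 v).symm.trans (h x.1 x.2)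

/-- the basis vector of the model representation -/
noncomputable def dl (n : ℕ) (mm : ℕ → ℕ → ℕ) (k : ℕ) (x : TIdx) : (Nrep n mm).V k :=
  fun y => if y.1 = x then (1 : ℂ) else 0

theorem cf_dl {n : ℕ} {mm : ℕ → ℕ → ℕ} {k : ℕ} {x : TIdx} (h : x ∈ NS n mm k) (y : TIdx) :
    cf n mm k y (dl n mm k x) = if y = x then 1 else 0 := by
  by_cases hy : y ∈ NS n mm k
  · exact extL_pos hy _
  · rw [cf_neg hy, if_neg]
    rintro rfl
    exact hy h

theorem Nrep_finrank (n : ℕ) (mm : ℕ → ℕ → ℕ) (k : ℕ) :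
    finrank ℂ ((Nrep n mm).V k) = (NS n mm k).card := by
  show finrank ℂ ({y // y ∈ NS n mm k} → ℂ) = _
  rw [Module.finrank_fintype_fun_eq_card, Fintype.card_coe]

/-- coordinates of a graded vector -/
noncomputable def XX {n : ℕ} {mm : ℕ → ℕ → ℕ} (v : ∀ i, (Nrep n mm).V i) (k : ℕ) (x : TIdx) : ℂ :=
  cf n mm k x (v k)

theorem XX_add {n : ℕ} {mm : ℕ → ℕ → ℕ} (v w : ∀ i, (Nrep n mm).V i) (k : ℕ) (x : TIdx) :
    XX (v + w) k x = XX v k x + XX w k x := map_add (cf n mm k x) _ _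

theorem XX_smul {n : ℕ} {mm : ℕ → ℕ → ℕ} (c : ℂ) (w : ∀ i, (Nrep n mm).V i) (k : ℕ) (x : TIdx) :
    XX (c • w) k x = c * XX w k x := map_smul (cf n mm k x) _ _

theorem XX_single {n : ℕ} {mm : ℕ → ℕ → ℕ} (i : ℕ) (v : (Nrep n mm).V i) (k : ℕ) (x : TIdx) :
    XX (Pi.single i v) k x = if k = i then cf n mm i x v else 0 := by
  unfold XX
  split_ifs with h
  · subst h; rw [Pi.single_eq_same]
  · rw [Pi.single_eq_of_ne h]; exact map_zero _

/-- the involution on copies of intervals -/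
def tau (n : ℕ) (mm : ℕ → ℕ → ℕ) (x : TIdx) : TIdx :=
  ⟨n - 1 - x.1 - x.2.1, x.2.1, mm x.1 x.2.1 - 1 - x.2.2⟩

section form
variable {n : ℕ} {mm : ℕ → ℕ → ℕ}

theorem tau_mem (hsym : ∀ a l, a + l < n → mm (n - 1 - a - l) l = mm a l)
    {x : TIdx} (hx : x ∈ NT n mm) : tau n mm x ∈ NT n mm := by
  rw [mem_NT] at hx ⊢
  simp only [tau]
  rw [hsym _ _ hx.1]
  omega

theorem tau_tau (hsym : ∀ a l, a + l < n → mm (n - 1 - a - l) l = mm a l)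
    {x : TIdx} (hx : x ∈ NT n mm) : tau n mm (tau n mm x) = x := by
  rw [mem_NT] at hx
  obtain ⟨a, l, u⟩ := x
  simp only [tau] at hx ⊢
  rw [hsym _ _ hx.1]
  have h1 : n - 1 - (n - 1 - a - l) - l = a := by omega
  have h2 : mm a l - 1 - (mm a l - 1 - u) = u := by omega
  rw [h1, h2]

theorem tau_mem_NS (hsym : ∀ a l, a + l < n → mm (n - 1 - a - l) l = mm a l)
    {x : TIdx} (hx : x ∈ NT n mm) {k p : ℕ} (h : k + p = n + 1) :
    tau n mm x ∈ NS n mm p ↔ x ∈ NS n mm k := by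
  rw [mem_NT] at hx
  rw [mem_NS, mem_NS]
  simp only [tau]
  rw [hsym _ _ hx.1]
  omega

noncomputable def formB (d : TIdx → ℂ) :
    (∀ i, (Nrep n mm).V i) →ₗ[ℂ] (∀ i, (Nrep n mm).V i) →ₗ[ℂ] ℂ :=
  LinearMap.mk₂ ℂ (fun v w => ∑ k ∈ Finset.Icc 1 n, ∑ x ∈ NT n mm,
      (-1) ^ k * d x * XX v k x * XX w (n + 1 - k) (tau n mm x))
    (by intro v v' w; simp only [XX_add, mul_add, add_mul, Finset.sum_add_distrib])
    (by
      intro c v w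
      simp only [XX_smul, smul_eq_mul, Finset.mul_sum]
      refine Finset.sum_congr rfl fun k _ => Finset.sum_congr rfl fun x _ => ?_
      ring)
    (by intro v w w'; simp only [XX_add, mul_add, Finset.sum_add_distrib])
    (by
      intro c v w
      simp only [XX_smul, smul_eq_mul, Finset.mul_sum]
      refine Finset.sum_congr rfl fun k _ => Finset.sum_congr rfl fun x _ => ?_
      ring)

theorem formB_apply (d : TIdx → ℂ) (v w : ∀ i, (Nrep n mm).V i) :
    formB d v w = ∑ k ∈ Finset.Icc 1 n, ∑ x ∈ NT n mm,
      (-1) ^ k * d x * XX v k x * XX w (n + 1 - k) (tau n mm x) := rfl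

theorem formB_single (d : TIdx → ℂ) (i j : ℕ) (hi : 1 ≤ i) (hj : 1 ≤ j) (h : i + j = n + 1)
    (v : (Nrep n mm).V i) (w : (Nrep n mm).V j) :
    formB d (Pi.single i v) (Pi.single j w) = ∑ x ∈ NT n mm,
      (-1) ^ i * d x * cf n mm i x v * cf n mm j (tau n mm x) w := by
  rw [formB_apply, Finset.sum_eq_single_of_mem i (Finset.mem_Icc.mpr ⟨hi, by omega⟩)]
  · refine Finset.sum_congr rfl fun x _ => ?_
    rw [XX_single, XX_single, if_pos rfl, if_pos (by omega)]
  · intro k _ hk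
    refine Finset.sum_eq_zero fun x _ => ?_
    rw [XX_single, if_neg hk]
    ring

theorem exists_form (hsym : ∀ a l, a + l < n → mm (n - 1 - a - l) l = mm a l)
    (ε : ℂ) (d : TIdx → ℂ) (hd0 : ∀ x, d x ≠ 0)
    (hd : ∀ x ∈ NT n mm, d x = ε * (-1) ^ (n + 1) * d (tau n mm x)) :
    Nonempty (EpsForm n (Nrep n mm) ε) := by
  refine ⟨⟨formB d, ?_, ?_, ?_, ?_⟩⟩
  · intro v hv
    funext k
    by_cases hk : k = 0 ∨ n < k
    · have := (Nrep n mm).triv k hk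
      exact Subsingleton.elim _ _
    apply cf_ext
    intro x hxS
    have hxT := NS_sub_NT hxS
    have hk' : k + (n + 1 - k) = n + 1 := by omega
    have hτ := (tau_mem_NS hsym hxT hk').mpr hxS
    have h1 := hv (Pi.single (n + 1 - k) (dl n mm (n + 1 - k) (tau n mm x)))
    rw [formB_apply, Finset.sum_eq_single_of_mem k (Finset.mem_Icc.mpr ⟨by omega, by omega⟩),
      Finset.sum_eq_single_of_mem x hxT] at h1
    · rw [XX_single, if_pos rfl, cf_dl hτ, if_pos rfl, mul_one] at h1
      rcases mul_eq_zero.mp h1 with h4 | h4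
      · exact absurd h4 (mul_ne_zero (pow_ne_zero _ (by norm_num)) (hd0 _))
      · exact h4
    · intro y hy hyx
      rw [XX_single, if_pos rfl, cf_dl hτ, if_neg, mul_zero]
      intro h
      apply hyx
      rw [← tau_tau hsym hy, h, tau_tau hsym hxT]
    · intro k' hk' hne
      refine Finset.sum_eq_zero fun y _ => ?_
      rw [Finset.mem_Icc] at hk'
      rw [XX_single, if_neg (by omega), mul_zero]
  · intro v w
    rw [formB_apply, formB_apply, Finset.mul_sum]
    refine Finset.sum_nbij' (fun k => n + 1 - k) (fun k => n + 1 - k) ?_ ?_ ?_ ?_ ?_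
    · intro k hk; simp only [Finset.mem_Icc] at hk ⊢; omega
    · intro k hk; simp only [Finset.mem_Icc] at hk ⊢; omega
    · intro k hk; simp only [Finset.mem_Icc] at hk ⊢; omega
    · intro k hk; simp only [Finset.mem_Icc] at hk ⊢; omega
    intro k hk
    rw [Finset.mem_Icc] at hk
    rw [Finset.mul_sum]
    refine Finset.sum_nbij' (tau n mm) (tau n mm) ?_ ?_ ?_ ?_ ?_
    · exact fun x hx => tau_mem hsym hx
    · exact fun x hx => tau_mem hsym hx
    · exact fun x hx => tau_tau hsym hx
    · exact fun x hx => tau_tau hsym hx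
    intro x hx
    rw [tau_tau hsym hx, hd x hx, show n + 1 - (n + 1 - k) = k by omega]
    have h1 : ((-1 : ℂ)) ^ k * (-1) ^ (n + 1) = (-1) ^ (n + 1 - k) := by
      rw [← pow_add, show k + (n + 1) = (n + 1 - k) + 2 * k by omega, pow_add, pow_mul]
      simp
    rw [← h1]
    ring
  · intro i j v w hij
    rw [formB_apply]
    refine Finset.sum_eq_zero fun k hk => Finset.sum_eq_zero fun x _ => ?_
    rw [Finset.mem_Icc] at hk
    rw [XX_single, XX_single]
    by_cases h : k = i
    · rw [if_neg (show ¬ (n + 1 - k = j) by omega), mul_zero]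
    · rw [if_neg h]; ring
  · intro i hi hin v w
    rw [formB_single d (i + 1) (n - i) (by omega) (by omega) (by omega),
      formB_single d i (n - i + 1) (by omega) (by omega) (by omega), ← Finset.sum_add_distrib]
    refine Finset.sum_eq_zero fun x hx => ?_
    have e1 := tau_mem_NS hsym hx (show (i + 1) + (n - i) = n + 1 by omega)
    have e2 := tau_mem_NS hsym hx (show i + (n - i + 1) = n + 1 by omega)
    by_cases h1 : x ∈ NS n mm (i + 1)
    · rw [cf_f_pos h1]
      by_cases h2 : x ∈ NS n mm i
      · rw [cf_f_pos (e2.mpr h2), pow_succ]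
        ring
      · rw [cf_neg h2]
        ring
    · rw [cf_neg h1]
      by_cases h2 : x ∈ NS n mm i
      · rw [cf_f_pos (e2.mpr h2), cf_neg (fun h => h1 (e1.mp h)) w]
        ring
      · rw [cf_neg h2]
        ring

end form

/-! ### Decomposition of a representation into intervals -/

theorem finrank_ker_inf_range {U V W : Type} [AddCommGroup U] [Module ℂ U]
    [AddCommGroup V] [Module ℂ V] [FiniteDimensional ℂ V] [AddCommGroup W] [Module ℂ W]
    (f : U →ₗ[ℂ] V) (g : V →ₗ[ℂ] W) :
    finrank ℂ (LinearMap.range (g.comp f)) + finrank ℂ ↥(LinearMap.ker g ⊓ LinearMap.range f)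
      = finrank ℂ (LinearMap.range f) := by
  have h := LinearMap.finrank_range_add_finrank_ker (g.domRestrict (LinearMap.range f))
  have h1 : LinearMap.range (g.domRestrict (LinearMap.range f)) = LinearMap.range (g.comp f) := by
    rw [LinearMap.range_domRestrict, LinearMap.range_comp]
  have h2 : (LinearMap.ker (g.domRestrict (LinearMap.range f))).map (LinearMap.range f).subtype
      = LinearMap.ker g ⊓ LinearMap.range f := by
    ext y
    simp only [Submodule.mem_map, LinearMap.mem_ker, LinearMap.domRestrict_apply,
      Submodule.mem_inf, Submodule.subtype_apply]
    constructor
    · rintro ⟨z, hz, rfl⟩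
      exact ⟨hz, z.2⟩
    · rintro ⟨hy, hy'⟩
      exact ⟨⟨y, hy'⟩, hy, rfl⟩
  rw [← h2, Submodule.finrank_map_subtype_eq, ← h1]
  exact h

section decomp
variable {n : ℕ} (M : ARep n)

theorem finrank_kerF_inf (a l : ℕ) :
    M.rho a (l + 1) + finrank ℂ ↥(LinearMap.ker (M.F (a + 1) l) ⊓ LinearMap.range (M.f a))
      = finrank ℂ (LinearMap.range (M.f a)) := by
  rw [← finrank_ker_inf_range (M.f a) (M.F (a + 1) l)]
  congr 1
  have h1 := LinearMap.finrank_range_add_finrank_ker ((M.F (a + 1) l).comp (M.f a))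
  have h2 := M.rho_add_ker a (l + 1)
  rw [M.ker_shift] at h1
  omega

theorem peel (a l : ℕ) : ∃ (m : ℕ) (s : ℕ → M.V (a + 1)),
    (∀ t, M.F (a + 1) (l + 1) (s t) = 0) ∧
    (LinearMap.ker (M.F (a + 1) (l + 1)) ≤
      (LinearMap.range (M.f a) ⊔ LinearMap.ker (M.F (a + 1) l)) ⊔
        Submodule.span ℂ {y | ∃ t < m, y = s t}) ∧
    m + M.rho (a + 1) (l + 1) + M.rho a (l + 1) = M.rho (a + 1) l + M.rho a (l + 2) := by
  have hK0 := M.rho_add_ker (a + 1) l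
  have hK1 := M.rho_add_ker (a + 1) (l + 1)
  have hI0 := finrank_kerF_inf M a l
  have hI1 := finrank_kerF_inf M a (l + 1)
  have hle : LinearMap.ker (M.F (a + 1) l) ≤ LinearMap.ker (M.F (a + 1) (l + 1)) := by
    intro x hx
    rw [LinearMap.mem_ker] at hx ⊢
    show M.f (a + 1 + l) (M.F (a + 1) l x) = 0
    rw [hx, map_zero]
  set K0 := LinearMap.ker (M.F (a + 1) l)
  set K1 := LinearMap.ker (M.F (a + 1) (l + 1))
  set I := LinearMap.range (M.f a)
  obtain ⟨C, hC⟩ := Submodule.exists_isCompl ((K1 ⊓ I) ⊔ K0)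
  have hP : (K1 ⊓ I) ⊔ K0 ≤ K1 := sup_le inf_le_left hle
  have hsup : ((K1 ⊓ I) ⊔ K0) ⊔ (C ⊓ K1) = K1 := by
    rw [← sup_inf_assoc_of_le C hP, hC.sup_eq_top, top_inf_eq]
  have hinf : ((K1 ⊓ I) ⊔ K0) ⊓ (C ⊓ K1) = ⊥ := by
    rw [← inf_assoc, hC.inf_eq_bot, bot_inf_eq]
  have d1 := Submodule.finrank_sup_add_finrank_inf_eq ((K1 ⊓ I) ⊔ K0) (C ⊓ K1)
  rw [hsup, hinf, finrank_bot] at d1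
  have d2 := Submodule.finrank_sup_add_finrank_inf_eq (K1 ⊓ I) K0
  have hKI : K1 ⊓ I ⊓ K0 = K0 ⊓ I := by
    rw [inf_right_comm, inf_eq_right.mpr hle]
  rw [hKI] at d2
  let e := Module.finBasis ℂ ↥(C ⊓ K1)
  refine ⟨finrank ℂ ↥(C ⊓ K1), fun t => if h : t < finrank ℂ ↥(C ⊓ K1) then (e ⟨t, h⟩ : M.V (a + 1))
    else 0, ?_, ?_, ?_⟩
  · intro t
    dsimp only
    split_ifs with h
    · exact (e ⟨t, h⟩).2.2
    · exact map_zero _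
  · refine hsup.ge.trans ?_
    refine sup_le_sup (sup_le_sup_right inf_le_right _) ?_
    intro y hy
    have h1 := e.sum_repr ⟨y, hy⟩
    have h2 := congrArg Subtype.val h1
    simp only [Submodule.coe_sum, Submodule.coe_smul] at h2
    rw [← h2]
    refine Submodule.sum_mem _ fun t _ => Submodule.smul_mem _ _ (Submodule.subset_span ?_)
    exact ⟨t.1, t.2, by simp⟩
  · show finrank ℂ ↥(C ⊓ K1) + M.rho (a + 1) (l + 1) + M.rho a (l + 1)
      = M.rho (a + 1) l + M.rho a (l + 2)
    have hI1' : M.rho a (l + 2) + finrank ℂ ↥(K1 ⊓ I) = finrank ℂ I := hI1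
    omega

/-- propagate a vector at `a+1` along the representation -/
noncomputable def GG (a : ℕ) (s : M.V (a + 1)) : (k : ℕ) → M.V k
  | 0 => 0
  | (k + 1) => M.f k (GG a s k) + (Pi.single (a + 1) s : ∀ i, M.V i) (k + 1)

theorem GG_succ (a : ℕ) (s : M.V (a + 1)) (k : ℕ) (h : k ≠ a) :
    GG M a s (k + 1) = M.f k (GG M a s k) := by
  rw [GG, Pi.single_eq_of_ne (by omega), add_zero]

theorem GG_low (a : ℕ) (s : M.V (a + 1)) (k : ℕ) (h : k ≤ a) : GG M a s k = 0 := by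
  induction k with
  | zero => rfl
  | succ k ih => rw [GG_succ _ _ _ _ (by omega), ih (by omega), map_zero]

theorem GG_start (a : ℕ) (s : M.V (a + 1)) : GG M a s (a + 1) = s := by
  rw [GG, GG_low _ _ _ _ le_rfl, map_zero, zero_add, Pi.single_eq_same]

theorem GG_F (a : ℕ) (s : M.V (a + 1)) (l : ℕ) : GG M a s (a + 1 + l) = M.F (a + 1) l s := by
  induction l with
  | zero => exact GG_start M a s
  | succ l ih =>
    show GG M a s (a + 1 + l + 1) = M.f (a + 1 + l) (M.F (a + 1) l s)
    rw [GG_succ _ _ _ _ (by omega), ih]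

variable (mm : ℕ → ℕ → ℕ) (s : ∀ a, ℕ → ℕ → M.V (a + 1))

noncomputable def phi (k : ℕ) : (Nrep n mm).V k →ₗ[ℂ] M.V k :=
  ∑ x ∈ NT n mm, (cf n mm k x).smulRight (GG M x.1 (s x.1 x.2.1 x.2.2) k)

theorem phi_apply (k : ℕ) (v : (Nrep n mm).V k) : phi M mm s k v =
    ∑ x ∈ NT n mm, cf n mm k x v • GG M x.1 (s x.1 x.2.1 x.2.2) k := by
  simp [phi, LinearMap.sum_apply]

theorem phi_comm (hs : ∀ a l t, M.F (a + 1) (l + 1) (s a l t) = 0) (k : ℕ) :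
    (phi M mm s (k + 1)).comp ((Nrep n mm).f k) = (M.f k).comp (phi M mm s k) := by
  apply LinearMap.ext
  intro v
  rw [LinearMap.comp_apply, LinearMap.comp_apply, phi_apply, phi_apply, map_sum]
  refine Finset.sum_congr rfl fun x hx => ?_
  rw [map_smul]
  by_cases h1 : x ∈ NS n mm k
  · rw [← GG_succ _ _ _ _ (by have := mem_NS.mp h1; omega)]
    by_cases h2 : x ∈ NS n mm (k + 1)
    · rw [cf_f_pos h2]
    · have hk : k = x.1 + 1 + x.2.1 := by rw [mem_NS] at h1 h2; omega
      have h0 : GG M x.1 (s x.1 x.2.1 x.2.2) (k + 1) = 0 := by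
        rw [hk]
        exact (GG_F M x.1 _ (x.2.1 + 1)).trans (hs _ _ _)
      rw [h0, smul_zero, smul_zero]
  · rw [cf_neg h1, zero_smul]
    by_cases h2 : x ∈ NS n mm (k + 1)
    · rw [cf_f_pos h2, cf_neg h1, zero_smul]
    · rw [cf_neg h2, zero_smul]

theorem phi_dl (a l u : ℕ) (h1 : a + l < n) (h2 : u < mm a l) :
    phi M mm s (a + 1) (dl n mm (a + 1) ⟨a, l, u⟩) = s a l u := by
  have hmem : (⟨a, l, u⟩ : TIdx) ∈ NS n mm (a + 1) := by
    rw [mem_NS]; dsimp only; omega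
  rw [phi_apply, Finset.sum_eq_single_of_mem _ (NS_sub_NT hmem)]
  · rw [cf_dl hmem, if_pos rfl, one_smul]
    exact GG_start M a _
  · intro y _ hy
    rw [cf_dl hmem, if_neg hy, zero_smul]

theorem phi_surj (hs : ∀ a l t, M.F (a + 1) (l + 1) (s a l t) = 0)
    (hspan : ∀ a l, LinearMap.ker (M.F (a + 1) (l + 1)) ≤
      (LinearMap.range (M.f a) ⊔ LinearMap.ker (M.F (a + 1) l)) ⊔
        Submodule.span ℂ {y | ∃ t < mm a l, y = s a l t}) (k : ℕ) :
    LinearMap.range (phi M mm s k) = ⊤ := by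
  induction k with
  | zero =>
    have : Subsingleton (M.V 0) := M.triv 0 (Or.inl rfl)
    exact Subsingleton.elim _ _
  | succ a ih =>
    by_cases ha : n < a + 1
    · have : Subsingleton (M.V (a + 1)) := M.triv _ (Or.inr ha)
      exact Subsingleton.elim _ _
    have hI : LinearMap.range (M.f a) ≤ LinearMap.range (phi M mm s (a + 1)) := by
      rintro _ ⟨y, rfl⟩
      have hy : y ∈ LinearMap.range (phi M mm s a) := by rw [ih]; trivial
      obtain ⟨v, rfl⟩ := hy
      exact ⟨_, LinearMap.congr_fun (phi_comm M mm s hs a) v⟩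
    have hK : ∀ l, a + l ≤ n →
        LinearMap.ker (M.F (a + 1) l) ≤ LinearMap.range (phi M mm s (a + 1)) := by
      intro l
      induction l with
      | zero =>
        intro _ x hx
        have : x = 0 := hx
        rw [this]; exact Submodule.zero_mem _
      | succ l ihl =>
        intro hl
        refine (hspan a l).trans (sup_le (sup_le hI (ihl (by omega))) ?_)
        rw [Submodule.span_le]
        rintro _ ⟨t, ht, rfl⟩
        exact ⟨_, phi_dl M mm s a l t (by omega) ht⟩
    rw [eq_top_iff]
    refine le_trans ?_ (hK (n - a) (by omega))
    intro x _
    have : Subsingleton (M.V (a + 1 + (n - a))) := M.triv _ (Or.inr (by omega))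
    exact Subsingleton.elim _ _

theorem NS_card (k : ℕ) (hk : k ≤ n)
    (hm : ∀ a l, mm a l + M.rho (a + 1) (l + 1) + M.rho a (l + 1)
      = M.rho (a + 1) l + M.rho a (l + 2)) :
    (NS n mm k).card = finrank ℂ (M.V k) := by
  have h1 : ((NS n mm k).card : ℤ) = ∑ a ∈ Finset.range k,
      ∑ l ∈ Finset.Ico (k - 1 - a) (n - a), (mm a l : ℤ) := by
    simp [NS, Finset.card_sigma]
  have h2 : ∀ a ∈ Finset.range k, ∑ l ∈ Finset.Ico (k - 1 - a) (n - a), (mm a l : ℤ)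
      = (M.rho (a + 1) (k - (a + 1)) : ℤ) - M.rho a (k - a) := by
    intro a ha
    rw [Finset.mem_range] at ha
    have h3 : ∀ l, (mm a l : ℤ) = ((M.rho (a + 1) l : ℤ) - M.rho a (l + 1))
        - ((M.rho (a + 1) (l + 1) : ℤ) - M.rho a (l + 1 + 1)) := by
      intro l
      have := hm a l
      have h4 : M.rho a (l + 1 + 1) = M.rho a (l + 2) := rfl
      omega
    have h5 := Finset.sum_range_sub' (fun t => (M.rho (a + 1) (k - 1 - a + t) : ℤ)
      - M.rho a (k - 1 - a + t + 1)) (n - a - (k - 1 - a))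
    rw [Finset.sum_Ico_eq_sum_range]
    rw [Finset.sum_congr rfl (fun t _ => h3 (k - 1 - a + t))]
    refine Eq.trans h5 ?_
    rw [show k - 1 - a + (n - a - (k - 1 - a)) = n - a by omega,
      M.rho_big (a + 1) (n - a) (by omega), M.rho_big a (n - a + 1) (by omega),
      show k - 1 - a + 0 = k - (a + 1) by omega, show k - (a + 1) + 1 = k - a by omega]
    simp
  rw [Finset.sum_congr rfl h2,
    Finset.sum_range_sub (fun a => (M.rho a (k - a) : ℤ)), M.rho_zero_left, Nat.sub_self,
    M.rho_zero_right] at h1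
  simpa using h1

theorem exists_decomp : ∃ mm : ℕ → ℕ → ℕ,
    (∀ a l, mm a l + M.rho (a + 1) (l + 1) + M.rho a (l + 1)
      = M.rho (a + 1) l + M.rho a (l + 2)) ∧ ARepIso (Nrep n mm) M := by
  choose mm s hs hspan hm using peel M
  refine ⟨mm, hm, ⟨phi M mm s, phi_comm M mm s hs⟩, fun k => ?_⟩
  have hsurj := LinearMap.range_eq_top.mp (phi_surj M mm s hs hspan k)
  refine ⟨?_, hsurj⟩
  show Function.Injective (phi M mm s k)
  by_cases hk : k ≤ n
  · rw [LinearMap.injective_iff_surjective_of_finrank_eq_finrank]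
    · exact hsurj
    · rw [Nrep_finrank, NS_card M mm k hk hm]
  · have := (Nrep n mm).triv k (Or.inr (by omega))
    exact Function.injective_of_subsingleton _

end decomp

theorem split_sign {n : ℕ} {ε : ℂ} (h : (Odd n ∧ ε = -1) ∨ (Even n ∧ ε = 1)) :
    ε * (-1) ^ (n + 1) = -1 := by
  rcases h with ⟨h, rfl⟩ | ⟨h, rfl⟩
  · rw [pow_succ, h.neg_one_pow]; norm_num
  · rw [pow_succ, h.neg_one_pow]; norm_num

theorem nonsplit_sign {n : ℕ} {ε : ℂ} (hε : ε = 1 ∨ ε = -1)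
    (h : ¬ ((Odd n ∧ ε = -1) ∨ (Even n ∧ ε = 1))) :
    ε * (-1) ^ (n + 1) = 1 := by
  rcases Nat.even_or_odd n with hn | hn
  · rcases hε with rfl | rfl
    · exact absurd (Or.inr ⟨hn, rfl⟩) h
    · rw [pow_succ, hn.neg_one_pow]; norm_num
  · rcases hε with rfl | rfl
    · rw [pow_succ, hn.neg_one_pow]; norm_num
    · exact absurd (Or.inl ⟨hn, rfl⟩) h

theorem eps_representation_rank_characterization (n : ℕ) (hn : 1 ≤ n)
    (M : ARep n) (ε : ℂ) (hε : ε = 1 ∨ ε = -1) :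
    (∃ (N : ARep n) (_ : EpsForm n N ε), ARepIso N M) ↔
      ((∀ i j, 1 ≤ i → i ≤ j → j ≤ n → M.r i j = M.r (n + 1 - j) (n + 1 - i)) ∧
       (((Odd n ∧ ε = -1) ∨ (Even n ∧ ε = 1)) →
         ∀ i, 1 ≤ i → i ≤ n + 1 - i → Even (M.r i (n + 1 - i)))) := by
  constructor
  · rintro ⟨N, E, hiso⟩
    have hε0 : ε ≠ 0 := by rcases hε with rfl | rfl <;> norm_num
    constructor
    · intro i j hi hij hj
      obtain ⟨k, rfl⟩ := Nat.exists_eq_add_of_le hij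
      rw [show n + 1 - i = n + 1 - (i + k) + k by omega, M.r_eq_rho, M.r_eq_rho,
        ← rho_iso hiso, ← rho_iso hiso]
      exact rho_symm E hε0 _ _ _ hi (by omega) (by omega)
    · intro hs i hi hin
      obtain ⟨k, hk⟩ := Nat.exists_eq_add_of_le hin
      rw [hk, M.r_eq_rho, ← rho_iso hiso]
      refine rho_even E i k hi (by omega) ?_
      have h1 := split_sign hs
      have h2 : ((-1 : ℂ)) ^ (2 * i) = 1 := by rw [pow_mul]; simp
      rw [show n + 1 = k + 2 * i by omega, pow_add, h2] at h1
      linear_combination h1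
  · rintro ⟨hsymm, heven⟩
    obtain ⟨mm, hm, hiso⟩ := exists_decomp M
    have hρ : ∀ i l p, i + l + p = n + 1 → M.rho i l = M.rho p l := by
      intro i l p h
      rcases Nat.eq_zero_or_pos i with rfl | hi
      · rw [M.rho_zero_left, M.rho_big p l (by omega)]
      rcases Nat.eq_zero_or_pos p with rfl | hp
      · rw [M.rho_zero_left, M.rho_big i l (by omega)]
      have := hsymm i (i + l) hi (by omega) (by omega)
      rwa [show n + 1 - i = n + 1 - (i + l) + l by omega, M.r_eq_rho, M.r_eq_rho,
        show n + 1 - (i + l) = p by omega] at this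
    have hsym : ∀ a l, a + l < n → mm (n - 1 - a - l) l = mm a l := by
      intro a l hal
      have h1 := hm a l
      have h2 := hm (n - 1 - a - l) l
      have e1 := hρ (a + 1) l (n - 1 - a - l + 1) (by omega)
      have e2 := hρ (a + 1) (l + 1) (n - 1 - a - l) (by omega)
      have e3 := hρ a (l + 1) (n - 1 - a - l + 1) (by omega)
      have e4 := hρ a (l + 2) (n - 1 - a - l) (by omega)
      omega
    have key : Nonempty (EpsForm n (Nrep n mm) ε) := by
      by_cases hs : (Odd n ∧ ε = -1) ∨ (Even n ∧ ε = 1)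
      · have hev : ∀ i l, i + l + i = n + 1 → Even (M.rho i l) := by
          intro i l h
          rcases Nat.eq_zero_or_pos i with rfl | hi
          · rw [M.rho_zero_left]; exact Even.zero
          have := heven hs i hi (by omega)
          rwa [show n + 1 - i = i + l by omega, M.r_eq_rho] at this
        have hmev : ∀ a l, a + l + a + 1 = n → Even (mm a l) := by
          intro a l h
          have h1 := hm a l
          have e2 := hρ (a + 1) (l + 1) a (by omega)
          obtain ⟨c1, hc1⟩ := hev (a + 1) l (by omega)
          obtain ⟨c2, hc2⟩ := hev a (l + 2) (by omega)
          rw [Nat.even_iff]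
          omega
        refine exists_form hsym ε (fun x => if x.1 + x.2.1 + x.1 + 1 < n then 1
          else if n < x.1 + x.2.1 + x.1 + 1 then -1
          else if 2 * x.2.2 < mm x.1 x.2.1 then 1 else -1) ?_ ?_
        · intro x
          split_ifs <;> norm_num
        · rintro ⟨a, l, u⟩ hx
          rw [mem_NT] at hx
          rw [split_sign hs]
          have hx1 : a + l < n := hx.1
          have hx2 : u < mm a l := hx.2
          have hsy := hsym a l hx1
          show (if a + l + a + 1 < n then (1 : ℂ) else if n < a + l + a + 1 then -1
            else if 2 * u < mm a l then 1 else -1)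
            = -1 * (if (n - 1 - a - l) + l + (n - 1 - a - l) + 1 < n then (1 : ℂ)
              else if n < (n - 1 - a - l) + l + (n - 1 - a - l) + 1 then -1
              else if 2 * (mm a l - 1 - u) < mm (n - 1 - a - l) l then 1 else -1)
          rcases lt_trichotomy (a + l + a + 1) n with h | h | h
          · rw [if_pos h, if_neg (by omega), if_pos (by omega)]; norm_num
          · rw [if_neg (show ¬ (a + l + a + 1 < n) by omega),
              if_neg (show ¬ (n < a + l + a + 1) by omega),
              if_neg (show ¬ ((n - 1 - a - l) + l + (n - 1 - a - l) + 1 < n) by omega),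
              if_neg (show ¬ (n < (n - 1 - a - l) + l + (n - 1 - a - l) + 1) by omega)]
            obtain ⟨c, hc⟩ := hmev a l h
            by_cases hu : 2 * u < mm a l
            · rw [if_pos hu, if_neg (by omega)]; norm_num
            · rw [if_neg hu, if_pos (by omega)]; norm_num
          · rw [if_neg (by omega), if_pos h, if_pos (by omega)]; norm_num
      · refine exists_form hsym ε (fun _ => 1) (fun _ => one_ne_zero) ?_
        intro x _
        rw [nonsplit_sign hε hs, mul_one]
    obtain ⟨E⟩ := key
    exact ⟨Nrep n mm, E, hiso⟩
end

section
/- Assume the split type: n odd with ε = −1, or n even with ε = +1. Let (M^0, ⟨−,−⟩) be a graded finite-dimensional ℂ-vector space with a σ-compatible ε-form and let M and N be ε-representations with underlying graded space M^0. Let G := {(g_1,…,g_n) : g_i ∈ GL(M_i) and ⟨g_i v, g_{σ(i)} w⟩ = ⟨v, w⟩ for all i, v ∈ M_i, w ∈ M_{σ(i)}} act on tuples of structure maps by (g·f)_i := g_{i+1} ∘ f_i ∘ g_i^{−1}. Then the tuple (f^N_1,…,f^N_{n−1}) lies in the closure of the G-orbit of (f^M_1,…,f^M_{n−1}) inside the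 finite-dimensional ℂ-vector space ∏_{i=1}^{n−1} Hom_ℂ(M_i, M_{i+1}) (with its standard topology as a finite-dimensional complex vector space) if and only if r^M_{i,j} ≥ r^N_{i,j} for all 1 ≤ i ≤ j ≤ n. -/
open Module

/-- The composite `f_{i,i+k} : M_i → M_{i+k}` of the structure maps of a point
`f ∈ ∏ Hom(M_i, M_{i+1})`, where `M_i = ℂ^{d i}`. -/
noncomputable def comps (d : ℕ → ℕ)
    (f : ∀ i, (Fin (d i) → ℂ) →ₗ[ℂ] (Fin (d (i + 1)) → ℂ)) (i : ℕ) :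
    (k : ℕ) → ((Fin (d i) → ℂ) →ₗ[ℂ] (Fin (d (i + k)) → ℂ))
  | 0 => LinearMap.id
  | (k + 1) => (f (i + k)).comp (comps d f i k)

/-- The rank sequence `r_{i,j} = rank f_{i,j}` of a tuple of structure maps. -/
noncomputable def rk (d : ℕ → ℕ)
    (f : ∀ i, (Fin (d i) → ℂ) →ₗ[ℂ] (Fin (d (i + 1)) → ℂ)) (i j : ℕ) : ℕ :=
  Module.finrank ℂ (LinearMap.range (comps d f i (j - i)))

namespace OrbC

/-- involution-indexed counting function -/
noncomputable def RR {T : Type} [Fintype T] (a : T → Bool → ℕ) (p q : ℕ) : ℤ :=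
  ∑ s : T × Bool, if a s.1 s.2 ≤ p ∧ a s.1 (!s.2) ≤ q then 1 else 0

lemma RR_symm {T : Type} [Fintype T] (a : T → Bool → ℕ) (p q : ℕ) : RR a p q = RR a q p := by
  unfold RR
  rw [Fintype.sum_prod_type, Fintype.sum_prod_type]
  refine Finset.sum_congr rfl fun t _ => ?_
  simp only [Fintype.sum_bool, Bool.not_true, Bool.not_false]
  rw [add_comm]
  simp only [and_comm]

lemma RR_even {T : Type} [Fintype T] (a : T → Bool → ℕ) (p : ℕ) : ∃ m, RR a p p = 2 * m := by
  unfold RR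
  rw [Fintype.sum_prod_type]
  refine ⟨∑ t : T, if a t true ≤ p ∧ a t false ≤ p then 1 else 0, ?_⟩
  rw [Finset.mul_sum]
  refine Finset.sum_congr rfl fun t _ => ?_
  simp only [Fintype.sum_bool, Bool.not_true, Bool.not_false]
  rw [two_mul]
  simp only [and_comm]

lemma RR_zero {T : Type} [Fintype T] (a : T → Bool → ℕ) (h1 : ∀ t b, 1 ≤ a t b) (q : ℕ) :
    RR a 0 q = 0 := by
  unfold RR
  refine Finset.sum_eq_zero fun s _ => if_neg ?_
  have := h1 s.1 s.2
  omega

/-- the number of points in a box -/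
lemma RR_box {T : Type} [Fintype T] (a : T → Bool → ℕ) {p p' q q' : ℕ} (hp : p ≤ p')
    (hq : q ≤ q') : RR a p' q' - RR a p' q - RR a p q' + RR a p q =
      ∑ s : T × Bool, if (p < a s.1 s.2 ∧ a s.1 s.2 ≤ p') ∧
        (q < a s.1 (!s.2) ∧ a s.1 (!s.2) ≤ q') then 1 else 0 := by
  unfold RR
  rw [← Finset.sum_sub_distrib, ← Finset.sum_sub_distrib, ← Finset.sum_add_distrib]
  refine Finset.sum_congr rfl fun s _ => ?_
  generalize a s.1 s.2 = u
  generalize a s.1 (!s.2) = w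
  split_ifs <;> omega

/-- The effect of an exchange on the counting function. -/
lemma RR_swap {T : Type} [Fintype T] [DecidableEq T] (a a' : T → Bool → ℕ) (s t : T)
    (hst : s ≠ t)
    (hs0 : a' s false = a s false) (hs1 : a' s true = a t true)
    (ht0 : a' t false = a t false) (ht1 : a' t true = a s true)
    (hr : ∀ r, r ≠ s → r ≠ t → ∀ b, a' r b = a r b)
    (h1 : a s false < a t false) (h2 : a t true < a s true) (p q : ℕ) :
    RR a' p q = RR a p q
      + (if (a s false ≤ p ∧ p < a t false) ∧ (a t true ≤ q ∧ q < a s true) then 1 else 0)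
      + (if (a s false ≤ q ∧ q < a t false) ∧ (a t true ≤ p ∧ p < a s true) then 1 else 0) := by
  unfold RR
  rw [Fintype.sum_prod_type, Fintype.sum_prod_type]
  rw [← Finset.add_sum_erase _ _ (Finset.mem_univ s),
    ← Finset.add_sum_erase _ _ (Finset.mem_erase.2 ⟨hst.symm, Finset.mem_univ t⟩)]
  rw [← Finset.add_sum_erase Finset.univ (fun x => ∑ y, if a (x, y).1 (x, y).2 ≤ p ∧
      a (x, y).1 (!(x, y).2) ≤ q then (1 : ℤ) else 0) (Finset.mem_univ s),
    ← Finset.add_sum_erase _ _ (Finset.mem_erase.2 ⟨hst.symm, Finset.mem_univ t⟩)]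
  have : ∑ x ∈ (Finset.univ.erase s).erase t, ∑ y, (if a' (x, y).1 (x, y).2 ≤ p ∧
      a' (x, y).1 (!(x, y).2) ≤ q then (1 : ℤ) else 0) =
      ∑ x ∈ (Finset.univ.erase s).erase t, ∑ y, (if a (x, y).1 (x, y).2 ≤ p ∧
      a (x, y).1 (!(x, y).2) ≤ q then (1 : ℤ) else 0) := by
    refine Finset.sum_congr rfl fun r hr' => ?_
    simp only [Finset.mem_erase, Finset.mem_univ, and_true] at hr'
    simp only [hr r hr'.2 hr'.1]
  rw [this]
  simp only [Fintype.sum_bool, Bool.not_true, Bool.not_false, hs0, hs1, ht0, ht1]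
  have key : ((if a t true ≤ p ∧ a s false ≤ q then (1:ℤ) else 0) +
      (if a s false ≤ p ∧ a t true ≤ q then 1 else 0)) +
      ((if a s true ≤ p ∧ a t false ≤ q then 1 else 0) +
        (if a t false ≤ p ∧ a s true ≤ q then 1 else 0)) =
      ((if a s true ≤ p ∧ a s false ≤ q then (1:ℤ) else 0) +
      (if a s false ≤ p ∧ a s true ≤ q then 1 else 0)) +
      ((if a t true ≤ p ∧ a t false ≤ q then 1 else 0) +
        (if a t false ≤ p ∧ a t true ≤ q then 1 else 0)) +
      (if (a s false ≤ p ∧ p < a t false) ∧ (a t true ≤ q ∧ q < a s true) then 1 else 0)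
      + (if (a s false ≤ q ∧ q < a t false) ∧ (a t true ≤ p ∧ p < a s true) then 1 else 0) := by
    have k1 : ∀ p q : ℕ, (if a s false ≤ p ∧ a t true ≤ q then (1:ℤ) else 0)
      + (if a t false ≤ p ∧ a s true ≤ q then 1 else 0) =
      (if a s false ≤ p ∧ a s true ≤ q then 1 else 0) +
        (if a t false ≤ p ∧ a t true ≤ q then 1 else 0) +
        (if (a s false ≤ p ∧ p < a t false) ∧ (a t true ≤ q ∧ q < a s true) then 1 else 0) := by
      intro p q
      split_ifs <;> omega
    have e1 := k1 p q
    have e2 := k1 q p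
    simp only [and_comm (a := a s false ≤ q), and_comm (a := a t false ≤ q)] at e2
    simp only [and_comm (a := a s false ≤ q)]
    linarith
  linarith

lemma arc_cases {T : Type} (s s0 : T × Bool) (h : s.1 = s0.1) : s = s0 ∨ s = (s0.1, !s0.2) := by
  obtain ⟨t, b⟩ := s
  obtain ⟨t0, b0⟩ := s0
  simp only at h
  subst h
  cases b <;> cases b0 <;> simp

set_option maxHeartbeats 1600000 in
/-- The key combinatorial lemma: find an elementary exchange staying below `M`. -/
lemma comb (n : ℕ) {T T' : Type} [Fintype T] [Fintype T'] (a : T → Bool → ℕ)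
    (a' : T' → Bool → ℕ) (h1 : ∀ t b, 1 ≤ a t b) (h1' : ∀ t b, 1 ≤ a' t b)
    (hle : ∀ p q, p + q ≤ n + 1 → RR a p q ≤ RR a' p q)
    (heq : ∀ p q, p + q = n + 1 → RR a p q = RR a' p q)
    (hne : ∃ p q, p + q ≤ n + 1 ∧ RR a p q ≠ RR a' p q) :
    ∃ s t : T × Bool, s.1 ≠ t.1 ∧ a s.1 s.2 < a t.1 t.2 ∧ a t.1 (!t.2) < a s.1 (!s.2) ∧
      a t.1 t.2 + a s.1 (!s.2) ≤ n + 2 ∧ a s.1 s.2 + a s.1 (!s.2) ≤ n + 1 ∧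
      ∀ p q, p + q ≤ n + 1 → RR a p q
        + (if (a s.1 s.2 ≤ p ∧ p < a t.1 t.2) ∧ (a t.1 (!t.2) ≤ q ∧ q < a s.1 (!s.2)) then 1 else 0)
        + (if (a s.1 s.2 ≤ q ∧ q < a t.1 t.2) ∧ (a t.1 (!t.2) ≤ p ∧ p < a s.1 (!s.2)) then 1 else 0)
        ≤ RR a' p q := by
  classical
  obtain ⟨D, hD⟩ : ∃ D : ℕ → ℕ → ℤ, ∀ p q, D p q = RR a' p q - RR a p q := ⟨_, fun _ _ => rfl⟩
  have Dsymm : ∀ p q, D p q = D q p := fun p q => by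
    rw [hD, hD, RR_symm a, RR_symm a']
  have D0 : ∀ p q, p + q ≤ n + 1 → 0 ≤ D p q := fun p q h => by
    have := hle p q h; rw [hD]; omega
  have Dbd : ∀ p q, p + q = n + 1 → D p q = 0 := fun p q h => by
    have := heq p q h; rw [hD]; omega
  have Deven : ∀ p, 1 ≤ D p p → 2 ≤ D p p := fun p h => by
    obtain ⟨m, hm⟩ := RR_even a p
    obtain ⟨m', hm'⟩ := RR_even a' p
    rw [hD] at *; omega
  have Dz : ∀ q, D 0 q = 0 := fun q => by rw [hD, RR_zero a h1, RR_zero a' h1']; rfl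
  have Dbox : ∀ p p' q q', p ≤ p' → q ≤ q' →
      D p' q + D p q' - D p q - (∑ s : T × Bool, if (p < a s.1 s.2 ∧ a s.1 s.2 ≤ p') ∧
        (q < a s.1 (!s.2) ∧ a s.1 (!s.2) ≤ q') then (1 : ℤ) else 0) ≤ D p' q' := by
    intro p p' q q' hp hq
    have e1 := RR_box a hp hq
    have e2 := RR_box a' hp hq
    have e3 : 0 ≤ ∑ s : T' × Bool, if (p < a' s.1 s.2 ∧ a' s.1 s.2 ≤ p') ∧
        (q < a' s.1 (!s.2) ∧ a' s.1 (!s.2) ≤ q') then (1 : ℤ) else 0 := by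
      refine Finset.sum_nonneg fun s _ => ?_
      split_ifs <;> simp
    simp only [hD]
    linarith
  have Dbox0 : ∀ p p' q q', p ≤ p' → q ≤ q' →
      (∀ s : T × Bool, ¬ ((p < a s.1 s.2 ∧ a s.1 s.2 ≤ p') ∧
        (q < a s.1 (!s.2) ∧ a s.1 (!s.2) ≤ q'))) →
      D p' q + D p q' - D p q ≤ D p' q' := by
    intro p p' q q' hp hq hno
    have := Dbox p p' q q' hp hq
    rw [Finset.sum_eq_zero (fun s _ => if_neg (hno s))] at this
    linarith
  -- choose x
  have hx : ∃ x, ∃ q, x + q ≤ n + 1 ∧ D x q ≠ 0 := by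
    obtain ⟨p, q, h, h'⟩ := hne
    exact ⟨p, q, h, by rw [hD]; omega⟩
  obtain ⟨x, hx1, hxmin⟩ : ∃ x, (∃ q, x + q ≤ n + 1 ∧ D x q ≠ 0) ∧
      ∀ p q, p < x → p + q ≤ n + 1 → D p q = 0 :=
    ⟨Nat.find hx, Nat.find_spec hx, fun p q hp hpq => by
      have := Nat.find_min hx hp
      push Not at this
      exact this q hpq⟩
  obtain ⟨y', ⟨hy1, hy2⟩, hymin⟩ : ∃ y', (x + y' ≤ n + 1 ∧ D x y' ≠ 0) ∧
      ∀ q, q < y' → D x q = 0 :=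
    ⟨Nat.find hx1, Nat.find_spec hx1, fun q hq => by
      have := Nat.find_min hx1 hq
      have h2 := (Nat.find_spec hx1).1
      push Not at this
      exact this (by omega)⟩
  have hxy' : x ≤ y' := by
    by_contra hlt
    exact hy2 (by rw [Dsymm]; exact hxmin y' x (by omega) (by omega))
  have hx0 : 1 ≤ x := by
    rcases Nat.eq_zero_or_pos x with h | h
    · subst h; exact absurd (Dz _) hy2
    · exact h
  have hDpos : 1 ≤ D x y' := by have := D0 x y' hy1; omega
  -- monotonicity along row x
  have mono : ∀ q q', y' ≤ q → q ≤ q' → x + q' ≤ n + 1 →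
      (∀ s : T × Bool, a s.1 s.2 = x → ¬ (y' < a s.1 (!s.2) ∧ a s.1 (!s.2) ≤ q')) →
      D x q ≤ D x q' := by
    intro q q' hq hqq hb hno
    have := Dbox0 (x - 1) x q q' (by omega) hqq (fun s hs => hno s (by omega) (by omega))
    rw [hxmin (x - 1) q' (by omega) (by omega), hxmin (x - 1) q (by omega) (by omega)] at this
    linarith
  have hy : ∃ y, y' < y ∧ x + y ≤ n + 1 ∧ ∃ s : T × Bool, a s.1 s.2 = x ∧ a s.1 (!s.2) = y := by
    by_contra hcon
    push Not at hcon
    have := mono y' (n + 1 - x) le_rfl (by omega) (by omega)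
      (fun s hs h => hcon _ h.1 (by omega) s hs rfl)
    rw [Dbd x (n + 1 - x) (by omega)] at this
    omega
  obtain ⟨y, ⟨hyy', hyn, s0, hs0x, hs0y⟩, hyfirst⟩ : ∃ y, (y' < y ∧ x + y ≤ n + 1 ∧
      ∃ s : T × Bool, a s.1 s.2 = x ∧ a s.1 (!s.2) = y) ∧
      ∀ s : T × Bool, a s.1 s.2 = x → ¬ (y' < a s.1 (!s.2) ∧ a s.1 (!s.2) < y) :=
    ⟨Nat.find hy, Nat.find_spec hy, fun s hs h => by
      have := Nat.find_min hy h.2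
      have h2 := (Nat.find_spec hy).2.1
      push Not at this
      exact this h.1 (by omega) s hs rfl⟩
  have mono2 : ∀ q q', y' ≤ q → q ≤ q' → q' < y → D x q ≤ D x q' := fun q q' h1 h2 h3 =>
    mono q q' h1 h2 (by omega) (fun s hs h => hyfirst s hs ⟨h.1, by omega⟩)
  -- positivity on strips free of candidates
  have L2 : ∀ p q, x ≤ p → y' ≤ q → q < y → p + q ≤ n + 1 →
      (∀ s : T × Bool, s.1 ≠ s0.1 → x < a s.1 s.2 → y' ≤ a s.1 (!s.2) → a s.1 (!s.2) < y →
        p < a s.1 s.2) → 1 ≤ D p q := by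
    intro p q hp hq hqy hpq hno
    have key := Dbox x p (y' - 1) q hp (by omega)
    have hDq : 1 ≤ D x q := le_trans hDpos (mono2 y' q le_rfl hq hqy)
    have e0 : 0 ≤ D p (y' - 1) := D0 _ _ (by omega)
    have e1 : D x (y' - 1) = 0 := hymin _ (by omega)
    have hs0' : ∀ s : T × Bool, s.1 = s0.1 → s ≠ (s0.1, !s0.2) → s = s0 :=
      fun s h h' => (arc_cases s s0 h).resolve_right h'
    rcases eq_or_lt_of_le hxy' with hxe | hxl
    · have h2 : 2 ≤ D x q := by
        have := Deven x (by rw [hxe] at hDpos ⊢; exact hDpos)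
        have h3 := mono2 y' q le_rfl hq hqy
        rw [← hxe] at h3
        omega
      have hc : (∑ s : T × Bool, if (x < a s.1 s.2 ∧ a s.1 s.2 ≤ p) ∧
        (y' - 1 < a s.1 (!s.2) ∧ a s.1 (!s.2) ≤ q) then (1 : ℤ) else 0) ≤ 1 := by
        calc _ ≤ ∑ s : T × Bool, if s = (s0.1, !s0.2) then (1 : ℤ) else 0 := by
              refine Finset.sum_le_sum fun s _ => ?_
              split_ifs with hA hB hB <;> try simp
              exfalso
              by_cases hs : s.1 = s0.1
              · have := hs0' s hs hB
                subst this
                omega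
              · have := hno s hs (by omega) (by omega) (by omega)
                omega
          _ = 1 := by simp
      linarith
    · have hc : (∑ s : T × Bool, if (x < a s.1 s.2 ∧ a s.1 s.2 ≤ p) ∧
        (y' - 1 < a s.1 (!s.2) ∧ a s.1 (!s.2) ≤ q) then (1 : ℤ) else 0) = 0 := by
        refine Finset.sum_eq_zero fun s _ => if_neg fun hA => ?_
        by_cases hs : s.1 = s0.1
        · by_cases hB : s = (s0.1, !s0.2)
          · subst hB
            simp only [Bool.not_not] at hA
            omega
          · have := hs0' s hs hB
            subst this
            omega
        · have := hno s hs (by omega) (by omega) (by omega)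
          omega
      linarith
  -- candidates
  have hex : ∃ x', ∃ s : T × Bool, s.1 ≠ s0.1 ∧ x < a s.1 s.2 ∧ y' ≤ a s.1 (!s.2) ∧
      a s.1 (!s.2) < y ∧ a s.1 s.2 = x' ∧ x' ≤ n + 2 - y := by
    by_contra hcon
    push Not at hcon
    have := L2 (n + 2 - y) (y - 1) (by omega) (by omega) (by omega) (by omega)
      (fun s h1 h2 h3 h4 => hcon _ s h1 h2 h3 h4 rfl)
    rw [Dbd _ _ (by omega)] at this
    omega
  obtain ⟨x', ⟨s1, hs1, hxx', hy'y'', hy''y, hs1x, hx'n⟩, hxfirst⟩ :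
      ∃ x', (∃ s : T × Bool, s.1 ≠ s0.1 ∧ x < a s.1 s.2 ∧ y' ≤ a s.1 (!s.2) ∧
      a s.1 (!s.2) < y ∧ a s.1 s.2 = x' ∧ x' ≤ n + 2 - y) ∧ 
      ∀ s : T × Bool, s.1 ≠ s0.1 → x < a s.1 s.2 → y' ≤ a s.1 (!s.2) → a s.1 (!s.2) < y →
        x' ≤ a s.1 s.2 :=
    ⟨Nat.find hex, Nat.find_spec hex, fun s h1 h2 h3 h4 => by
      by_contra hlt
      push Not at hlt
      refine Nat.find_min hex hlt ⟨s, h1, h2, h3, h4, rfl, ?_⟩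
      obtain ⟨_, _, _, _, _, _, h5⟩ := Nat.find_spec hex
      omega⟩
  have L2' : ∀ p q, x ≤ p → p < x' → y' ≤ q → q < y → p + q ≤ n + 1 → 1 ≤ D p q :=
    fun p q h1 h2 h3 h4 h5 => L2 p q h1 h3 h4 h5 (fun s g1 g2 g3 g4 => by
      have := hxfirst s g1 g2 g3 g4
      omega)
  have L5 : ∀ p q, y' ≤ p → p ≤ q → q < x' → q < y → p + q ≤ n + 1 → 2 ≤ D p q := by
    intro p q h1 h2 h3 h4 h5
    have e1 := Deven p (L2' p p (by omega) (by omega) (by omega) (by omega) (by omega))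
    have e2 := mono2 p q h1 h2 h4
    have e3 := Dbox0 x p p q (by omega) h2 (fun s hs => by
      by_cases h : s.1 = s0.1
      · rcases arc_cases s s0 h with rfl | rfl
        · omega
        · simp only [Bool.not_not] at hs
          omega
      · have := hxfirst s h (by omega) (by omega) (by omega)
        omega)
    linarith
  refine ⟨s0, s1, hs1.symm, by omega, by omega, by omega, by omega, ?_⟩
  intro p q hpq
  rw [hs0x, hs1x, hs0y]
  have base := D0 p q hpq
  have eD := hD p q
  split_ifs with hA hB hB
  · have : 2 ≤ D p q := by
      rcases le_total p q with h | h
      · exact L5 p q (by omega) h (by omega) (by omega) hpq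
      · rw [Dsymm]; exact L5 q p (by omega) h (by omega) (by omega) (by omega)
    omega
  · have := L2' p q (by omega) (by omega) (by omega) (by omega) hpq
    omega
  · have := L2' q p (by omega) (by omega) (by omega) (by omega) (by omega)
    rw [Dsymm] at this
    omega
  · omega

end OrbC

namespace OrbC

set_option linter.unusedSectionVars false

/-- A graded symplectic space with grading projections `P i`. -/
structure GSys (n : ℕ) (V : Type) [AddCommGroup V] [Module ℂ V] where
  P : ℕ → V →ₗ[ℂ] V
  ω : V →ₗ[ℂ] V →ₗ[ℂ] ℂ
  PP : ∀ i v, P i (P i v) = P i v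
  PPne : ∀ i j v, i ≠ j → P i (P j v) = 0
  sum : ∀ v, ∑ i ∈ Finset.range (n + 1), P i v = v
  P0 : ∀ v, P 0 v = 0
  Pn : ∀ i v, n < i → P i v = 0
  alt : ∀ v w, ω v w = - ω w v
  nd : ∀ v, (∀ w, ω v w = 0) → v = 0
  gr : ∀ i j v w, i + j ≠ n + 1 → ω (P i v) (P j w) = 0

variable {n : ℕ} {V : Type} [AddCommGroup V] [Module ℂ V]

/-- Selfadjoint operators of degree one. -/
structure GSys.IsOp (G : GSys n V) (F : V →ₗ[ℂ] V) : Prop where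
  deg : ∀ i v, F (G.P i v) = G.P (i + 1) (F v)
  sa : ∀ v w, G.ω (F v) w = G.ω v (F w)

namespace GSys

variable {G : GSys n V} {F : V →ₗ[ℂ] V}

lemma IsOp.pow_deg (h : G.IsOp F) (k i : ℕ) (v : V) :
    (F ^ k) (G.P i v) = G.P (i + k) ((F ^ k) v) := by
  induction k with
  | zero => simp
  | succ k ih =>
    rw [pow_succ', Module.End.mul_apply, ih, h.deg, Module.End.mul_apply]
    rfl

lemma IsOp.hom_pow (h : G.IsOp F) {p : ℕ} {v : V} (hv : G.P p v = v) (k : ℕ) :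
    G.P (p + k) ((F ^ k) v) = (F ^ k) v := by
  rw [← h.pow_deg, hv]

lemma IsOp.pow_sa (h : G.IsOp F) (k : ℕ) (v w : V) :
    G.ω ((F ^ k) v) w = G.ω v ((F ^ k) w) := by
  induction k generalizing v w with
  | zero => simp
  | succ k ih =>
    rw [pow_succ', Module.End.mul_apply, h.sa, ih, ← Module.End.mul_apply, ← pow_succ, pow_succ']

lemma IsOp.pow_pow (h : G.IsOp F) (k l : ℕ) (v w : V) :
    G.ω ((F ^ k) v) ((F ^ l) w) = G.ω ((F ^ (k + l)) v) w := by
  rw [← h.pow_sa, ← Module.End.mul_apply, ← pow_add, add_comm]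

lemma IsOp.self (h : G.IsOp F) (k : ℕ) (v : V) : G.ω ((F ^ k) v) v = 0 := by
  have h1 := G.alt ((F ^ k) v) v
  rw [← h.pow_sa] at h1
  exact self_eq_neg.1 h1

lemma IsOp.swap (h : G.IsOp F) (k : ℕ) (v w : V) : G.ω ((F ^ k) v) w = - G.ω ((F ^ k) w) v := by
  rw [G.alt, ← h.pow_sa]

lemma om_hom (G : GSys n V) {p q : ℕ} {v w : V} (hv : G.P p v = v) (hw : G.P q w = w)
    (hpq : p + q ≠ n + 1) : G.ω v w = 0 := by
  rw [← hv, ← hw]; exact G.gr _ _ _ _ hpq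

lemma hom_ne (G : GSys n V) {p q : ℕ} {v : V} (hv : G.P p v = v) (hpq : q ≠ p) :
    G.P q v = 0 := by
  rw [← hv]; exact G.PPne _ _ _ hpq

lemma IsOp.pow_zero (h : G.IsOp F) {k : ℕ} (hk : n ≤ k) (v : V) : (F ^ k) v = 0 := by
  rw [← G.sum v, map_sum]
  refine Finset.sum_eq_zero fun i _ => ?_
  rcases Nat.eq_zero_or_pos i with rfl | hi
  · rw [G.P0, map_zero]
  · rw [h.pow_deg, G.Pn _ _ (by omega)]

end GSys

/-- A system of generators adapted to `F`. -/
structure Adp (G : GSys n V) (F : V →ₗ[ℂ] V) {T : Type} [Fintype T] (a : T → Bool → ℕ)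
    (v : T → Bool → V) : Prop where
  pos : ∀ t b, 1 ≤ a t b
  le : ∀ t, a t false + a t true ≤ n + 2
  hom : ∀ t b, G.P (a t b) (v t b) = v t b
  orth : ∀ t t' b b', t ≠ t' → ∀ k, G.ω ((F ^ k) (v t b)) (v t' b') = 0
  one : ∀ t, a t false + a t true ≤ n + 1 →
    G.ω ((F ^ (n + 1 - (a t false + a t true))) (v t false)) (v t true) = 1
  card : ∑ t, 2 * (n + 2 - (a t false + a t true)) = finrank ℂ V

section
variable {G : GSys n V} {F : V →ₗ[ℂ] V} {T : Type} [Fintype T] {a : T → Bool → ℕ}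
  {v : T → Bool → V}

/-- the sign attached to an orientation -/
def sgn (b : Bool) : ℂ := if b then -1 else 1

lemma sgn_ne (b : Bool) : sgn b ≠ 0 := by cases b <;> simp [sgn]

open Classical in
lemma pairing (hF : G.IsOp F)
    (hom : ∀ t b, G.P (a t b) (v t b) = v t b)
    (orth : ∀ t t' b b', t ≠ t' → ∀ k, G.ω ((F ^ k) (v t b)) (v t' b') = 0)
    (one : ∀ t, a t false + a t true ≤ n + 1 →
      G.ω ((F ^ (n + 1 - (a t false + a t true))) (v t false)) (v t true) = 1)
    (s s' : T × Bool) (k l : ℕ) :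
    G.ω ((F ^ k) (v s.1 s.2)) ((F ^ l) (v s'.1 s'.2)) =
      if s' = (s.1, !s.2) ∧ a s.1 s.2 + k + l + a s.1 (!s.2) = n + 1 then sgn s.2 else 0 := by
  obtain ⟨t, b⟩ := s
  obtain ⟨t', b'⟩ := s'
  rw [hF.pow_pow]
  simp only [Prod.mk.injEq]
  by_cases ht : t' = t
  · subst ht
    by_cases hb : b' = !b
    · subst hb
      by_cases hd : a t' b + k + l + a t' (!b) = n + 1
      · simp only [hd, and_self, if_true]
        cases b
        · simp only [Bool.not_false] at hd ⊢
          have := one t' (by omega)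
          rw [show n + 1 - (a t' false + a t' true) = k + l by omega] at this
          rw [this]; rfl
        · simp only [Bool.not_true] at hd ⊢
          have := one t' (by omega)
          rw [show n + 1 - (a t' false + a t' true) = k + l by omega] at this
          rw [hF.swap, this]; rfl
      · rw [if_neg (by tauto)]
        exact G.om_hom (hF.hom_pow (hom _ _) _) (hom _ _) (by omega)
    · have : b' = b := by cases b <;> cases b' <;> simp_all
      subst this
      rw [if_neg (by tauto), hF.self]
  · rw [if_neg (by tauto), orth _ _ _ _ (Ne.symm ht)]

/-- index type of the basis attached to an adapted system -/
abbrev Idx (n : ℕ) {T : Type} (a : T → Bool → ℕ) : Type :=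
  Σ s : T × Bool, Fin (n + 2 - (a s.1 s.2 + a s.1 (!s.2)))

/-- the basis vectors -/
def vec (F : V →ₗ[ℂ] V) (n : ℕ) (a : T → Bool → ℕ) (v : T → Bool → V) (i : Idx n a) : V :=
  (F ^ (i.2 : ℕ)) (v i.1.1 i.1.2)

lemma bar_inj {T : Type} {s s' : T × Bool} (h : (s.1, !s.2) = (s'.1, !s'.2)) : s = s' := by
  obtain ⟨t, b⟩ := s
  obtain ⟨t', b'⟩ := s'
  rw [Prod.mk.injEq] at h
  obtain ⟨h1, h2⟩ := h
  simp only at h1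
  subst h1
  cases b <;> cases b' <;> simp_all

lemma vec_li (hF : G.IsOp F)
    (hom : ∀ t b, G.P (a t b) (v t b) = v t b)
    (orth : ∀ t t' b b', t ≠ t' → ∀ k, G.ω ((F ^ k) (v t b)) (v t' b') = 0)
    (one : ∀ t, a t false + a t true ≤ n + 1 →
      G.ω ((F ^ (n + 1 - (a t false + a t true))) (v t false)) (v t true) = 1) :
    LinearIndependent ℂ (vec F n a v) := by
  classical
  rw [Fintype.linearIndependent_iff]
  rintro c hc ⟨s, j⟩
  have h := congrArg (fun u => G.ω u ((F ^ (n + 1 - (a s.1 s.2 + a s.1 (!s.2)) - j))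
    (v s.1 (!s.2)))) hc
  simp only [map_sum, map_smul, LinearMap.sum_apply, LinearMap.smul_apply, map_zero,
    LinearMap.zero_apply] at h
  rw [Finset.sum_eq_single (⟨s, j⟩ : Idx n a)] at h
  · have hp := pairing hF hom orth one s (s.1, !s.2) j (n + 1 - (a s.1 s.2 + a s.1 (!s.2)) - j)
    rw [if_pos ⟨rfl, by have := j.2; omega⟩] at hp
    simp only [vec] at h
    rw [hp] at h
    simpa [sgn_ne] using h
  · rintro ⟨s', j'⟩ _ hne
    have hp := pairing hF hom orth one s' (s.1, !s.2) j' (n + 1 - (a s.1 s.2 + a s.1 (!s.2)) - j)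
    simp only [vec]
    rw [hp, if_neg, smul_zero]
    rintro ⟨h1, h2⟩
    apply hne
    have : s = s' := bar_inj h1
    subst this
    have h4 := j.2
    have h3 : j = j' := by
      apply Fin.ext
      omega
    rw [h3]
  · intro h; exact absurd (Finset.mem_univ _) h

lemma card_Idx : Fintype.card (Idx n a) = ∑ t, 2 * (n + 2 - (a t false + a t true)) := by
  rw [Fintype.card_sigma, Fintype.sum_prod_type]
  refine Finset.sum_congr rfl fun t _ => ?_
  simp only [Fintype.sum_bool, Fintype.card_fin, Bool.not_true, Bool.not_false]
  rw [add_comm (a t true), two_mul]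



lemma exists_bas [FiniteDimensional ℂ V] (hF : G.IsOp F) (h : Adp G F a v) :
    ∃ b : Basis (Idx n a) ℂ V, ∀ i, b i = vec F n a v i := by
  have li := vec_li hF h.hom h.orth h.one
  have hc : Fintype.card (Idx n a) = finrank ℂ V := by rw [card_Idx, h.card]
  have hsp : ⊤ ≤ Submodule.span ℂ (Set.range (vec F n a v)) :=
    (li.span_eq_top_of_card_eq_finrank' hc).ge
  exact ⟨Basis.mk li hsp, fun i => by simp⟩

/-- Overlong powers vanish. -/
lemma vec_zero [FiniteDimensional ℂ V] (hF : G.IsOp F) (h : Adp G F a v) (s : T × Bool) (k : ℕ)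
    (hk : n + 2 ≤ a s.1 s.2 + a s.1 (!s.2) + k) : (F ^ k) (v s.1 s.2) = 0 := by
  classical
  obtain ⟨b, hb⟩ := exists_bas hF h
  apply G.nd
  intro w
  have : G.ω ((F ^ k) (v s.1 s.2)) = 0 := by
    apply b.ext
    intro i
    rw [hb]
    have hp := pairing hF h.hom h.orth h.one s i.1 k i.2
    unfold vec
    rw [hp, if_neg (by rintro ⟨h1, h2⟩; omega)]
    rfl
  rw [this]; rfl

lemma rank_formula [FiniteDimensional ℂ V] (hF : G.IsOp F) (h : Adp G F a v) (p q : ℕ)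
    (hpq : p + q ≤ n + 1) :
    (finrank ℂ (LinearMap.range ((F ^ (n + 1 - p - q)) ∘ₗ G.P p)) : ℤ) = RR a p q := by
  classical
  obtain ⟨b, hb⟩ := exists_bas hF h
  have li := vec_li hF h.hom h.orth h.one
  set k := n + 1 - p - q with hk
  let S := {s : T × Bool // a s.1 s.2 ≤ p ∧ a s.1 (!s.2) ≤ q}
  let φ : S → Idx n a := fun s => ⟨s.1, ⟨p - a s.1.1 s.1.2 + k, by have := s.2; omega⟩⟩
  have hφ : Function.Injective φ := by
    intro s s' hs
    exact Subtype.ext (congrArg Sigma.fst hs)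
  have himg : ∀ i : Idx n a, (F ^ k) (G.P p (vec F n a v i)) =
      if a i.1.1 i.1.2 + i.2 = p then (F ^ (k + i.2)) (v i.1.1 i.1.2) else 0 := by
    intro i
    have hi : G.P (a i.1.1 i.1.2 + i.2) (vec F n a v i) = vec F n a v i :=
      hF.hom_pow (h.hom _ _) _
    split_ifs with hc
    · rw [hc] at hi
      rw [hi, pow_add]; rfl
    · rw [G.hom_ne hi (Ne.symm hc), map_zero]
  have hr : LinearMap.range ((F ^ k) ∘ₗ G.P p) = Submodule.span ℂ (Set.range (vec F n a v ∘ φ)) := by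
    rw [LinearMap.range_eq_map, ← b.span_eq, Submodule.map_span]
    apply le_antisymm
    · rw [Submodule.span_le]
      rintro _ ⟨_, ⟨i, rfl⟩, rfl⟩
      rw [LinearMap.comp_apply, hb, himg]
      split_ifs with hc
      · by_cases hq : a i.1.1 (!i.1.2) ≤ q
        · apply Submodule.subset_span
          refine ⟨⟨i.1, by omega, hq⟩, ?_⟩
          simp only [Function.comp, φ, vec]
          rw [show p - a i.1.1 i.1.2 + k = k + i.2 by omega]
        · rw [vec_zero hF h _ _ (by omega)]
          exact Submodule.zero_mem _
      · exact Submodule.zero_mem _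
    · rw [Submodule.span_le]
      rintro _ ⟨s, rfl⟩
      apply Submodule.subset_span
      refine ⟨_, ⟨⟨s.1, ⟨p - a s.1.1 s.1.2, by have := s.2; omega⟩⟩, rfl⟩, ?_⟩
      rw [LinearMap.comp_apply, hb, himg, if_pos (by have := s.2; simp only; omega)]
      simp only [Function.comp, φ, vec]
      rw [add_comm]
  rw [hr, finrank_span_eq_card (li.comp φ hφ)]
  unfold RR
  rw [Finset.sum_boole, Fintype.card_subtype]

end
end OrbC

namespace OrbC
variable {n : ℕ} {V : Type} [AddCommGroup V] [Module ℂ V]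
variable {G : GSys n V} {F : V →ₗ[ℂ] V}

lemma GSys.om_P (G : GSys n V) {q i : ℕ} {w : V} (hw : G.P q w = w) (hiq : i + q = n + 1) (X : V) :
    G.ω (G.P i X) w = G.ω X w := by
  by_cases hi : i ≤ n
  · conv_rhs => rw [← G.sum X]
    rw [map_sum, LinearMap.sum_apply, Finset.sum_eq_single i]
    · intro j _ hj
      exact G.om_hom (G.PP j X) hw (by omega)
    · intro h; exact absurd (Finset.mem_range.2 (by omega)) h
  · have hq : q = 0 := by omega
    subst hq
    rw [G.P0] at hw
    rw [← hw]; simp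

lemma GSys.om_P' (G : GSys n V) {q i : ℕ} {w : V} (hw : G.P q w = w) (hiq : i + q ≠ n + 1) (X : V) :
    G.ω (G.P i X) w = 0 := G.om_hom (G.PP i X) hw hiq

set_option maxHeartbeats 1000000 in
lemma decomp_aux [FiniteDimensional ℂ V] (hF : G.IsOp F) (m : ℕ) : ∀ U : Submodule ℂ V,
    finrank ℂ U = m → (∀ i, ∀ u ∈ U, G.P i u ∈ U) → (∀ u ∈ U, F u ∈ U) →
    (∀ u ∈ U, (∀ w ∈ U, G.ω u w = 0) → u = 0) →
    ∃ (T : Type) (_ : Fintype T) (a : T → Bool → ℕ) (v : T → Bool → V),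
      (∀ t b, v t b ∈ U) ∧ (∀ t b, 1 ≤ a t b) ∧ (∀ t, a t false + a t true ≤ n + 1) ∧
      (∀ t b, G.P (a t b) (v t b) = v t b) ∧
      (∀ t t' b b', t ≠ t' → ∀ k, G.ω ((F ^ k) (v t b)) (v t' b') = 0) ∧
      (∀ t, a t false + a t true ≤ n + 1 →
        G.ω ((F ^ (n + 1 - (a t false + a t true))) (v t false)) (v t true) = 1) ∧
      U ≤ Submodule.span ℂ (Set.range fun i : (T × Bool) × ℕ => (F ^ i.2) (v i.1.1 i.1.2)) := by
  induction m using Nat.strong_induction_on with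
  | _ m ih =>
  intro U hUm hUP hUF hUn
  by_cases hU : U = ⊥
  · refine ⟨Empty, inferInstance, fun t => t.elim, fun t => t.elim, fun t => t.elim,
      fun t => t.elim, fun t => t.elim, fun t => t.elim, fun t => t.elim, fun t => t.elim, ?_⟩
    rw [hU]; exact bot_le
  have hUFk : ∀ k, ∀ u ∈ U, (F ^ k) u ∈ U := by
    intro k
    induction k with
    | zero => intro u hu; simpa using hu
    | succ k ihk => intro u hu; rw [pow_succ', Module.End.mul_apply]; exact hUF _ (ihk u hu)
  -- the nilpotency index on U
  have hex : ∃ k, ∀ u ∈ U, (F ^ k) u = 0 := ⟨n, fun u _ => hF.pow_zero le_rfl u⟩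
  obtain ⟨k, hk0, u0, hu0, hku0⟩ : ∃ k, (∀ u ∈ U, (F ^ (k + 1)) u = 0) ∧ ∃ u ∈ U, (F ^ k) u ≠ 0 := by
    classical
    have h1 := Nat.find_spec hex
    rcases Nat.eq_zero_or_pos (Nat.find hex) with h0 | h0
    · exfalso
      apply hU
      rw [eq_bot_iff]
      intro u hu
      have := h1 u hu
      rw [h0] at this
      simpa using this
    · refine ⟨Nat.find hex - 1, ?_, ?_⟩
      · rw [Nat.sub_add_cancel h0]; exact h1
      · have := Nat.find_min hex (m := Nat.find hex - 1) (by omega)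
        push Not at this
        exact this
  have hk1 : ∀ i, k < i → ∀ u ∈ U, (F ^ i) u = 0 := by
    intro i hi u hu
    obtain ⟨j, rfl⟩ := Nat.exists_eq_add_of_lt hi
    rw [show k + j + 1 = j + (k + 1) by ring, pow_add, Module.End.mul_apply, hk0 u hu, map_zero]
  obtain ⟨α, hα⟩ : ∃ α, (F ^ k) (G.P α u0) ≠ 0 := by
    by_contra hcon
    push Not at hcon
    apply hku0
    rw [← G.sum u0, map_sum]
    exact Finset.sum_eq_zero fun i _ => hcon i
  obtain ⟨v, hvU, hvα, hv⟩ : ∃ v ∈ U, G.P α v = v ∧ (F ^ k) v ≠ 0 :=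
    ⟨G.P α u0, hUP _ _ hu0, G.PP _ _, hα⟩
  have hα1 : 1 ≤ α := by
    rcases Nat.eq_zero_or_pos α with h | h
    · subst h; rw [G.P0] at hvα; rw [← hvα] at hv; simp at hv
    · exact h
  have hFv := hF.hom_pow hvα k
  have hαk : α + k ≤ n := by
    by_contra hcon
    rw [G.Pn _ _ (by omega)] at hFv
    exact hv hFv.symm
  obtain ⟨w0, hw0U, hw0⟩ : ∃ w ∈ U, G.ω ((F ^ k) v) w ≠ 0 := by
    by_contra hcon
    push Not at hcon
    exact hv (hUn _ (hUFk _ _ hvU) hcon)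
  set β := n + 1 - (α + k) with hβ
  obtain ⟨w, hwU, hwβ, hw⟩ : ∃ w ∈ U, G.P β w = w ∧ G.ω ((F ^ k) v) w = 1 := by
    have h1 : G.ω ((F ^ k) v) (G.P β w0) = G.ω ((F ^ k) v) w0 := by
      rw [G.alt, G.om_P hFv (by omega), ← G.alt]
    refine ⟨(G.ω ((F ^ k) v) w0)⁻¹ • G.P β w0, U.smul_mem _ (hUP _ _ hw0U), ?_, ?_⟩
    · rw [map_smul, G.PP]
    · rw [map_smul, h1, smul_eq_mul, inv_mul_cancel₀ hw0]
  have hvw : ∀ m, G.ω ((F ^ m) v) w = if m = k then 1 else 0 := by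
    intro m
    split_ifs with h
    · rw [h, hw]
    · exact G.om_hom (hF.hom_pow hvα m) hwβ (by omega)
  have hwv : ∀ m, G.ω ((F ^ m) w) v = if m = k then -1 else 0 := by
    intro m
    rw [hF.swap, hvw]
    split_ifs <;> simp
  -- the complement
  let U' : Submodule ℂ V :=
    { carrier := {u | u ∈ U ∧ ∀ j, G.ω u ((F ^ j) v) = 0 ∧ G.ω u ((F ^ j) w) = 0}
      add_mem' := by
        rintro x y ⟨hx, hx'⟩ ⟨hy, hy'⟩
        refine ⟨U.add_mem hx hy, fun j => ?_⟩
        simp [(hx' j).1, (hx' j).2, (hy' j).1, (hy' j).2]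
      zero_mem' := ⟨U.zero_mem, fun j => by simp⟩
      smul_mem' := by
        rintro c x ⟨hx, hx'⟩
        refine ⟨U.smul_mem _ hx, fun j => ?_⟩
        simp [(hx' j).1, (hx' j).2] }
  have memU' : ∀ u, u ∈ U' ↔ u ∈ U ∧ ∀ j, G.ω u ((F ^ j) v) = 0 ∧ G.ω u ((F ^ j) w) = 0 :=
    fun u => Iff.rfl
  have hU'U : U' ≤ U := fun u hu => hu.1
  have hU'lt : U' < U := by
    refine lt_of_le_of_ne hU'U fun h => ?_
    have h1 : v ∈ U' := h ▸ hvU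
    have h2 := (h1.2 k).2
    rw [← hF.pow_sa, hw] at h2
    exact one_ne_zero h2
  have hproj : ∀ u ∈ U, ∃ u' ∈ U', ∃ c e : ℕ → ℂ,
      u = u' + ∑ j ∈ Finset.range (k + 1), (c j • (F ^ j) v + e j • (F ^ j) w) := by
    intro u hu
    refine ⟨u - ∑ j ∈ Finset.range (k + 1), ((G.ω u ((F ^ (k - j)) w)) • (F ^ j) v +
      (- G.ω u ((F ^ (k - j)) v)) • (F ^ j) w), ?_, _, _, (sub_add_cancel _ _).symm⟩
    refine ⟨U.sub_mem hu (U.sum_mem fun j _ => U.add_mem (U.smul_mem _ (hUFk _ _ hvU))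
      (U.smul_mem _ (hUFk _ _ hwU))), fun i => ?_⟩
    by_cases hi : k < i
    · rw [hk1 i hi v hvU, hk1 i hi w hwU]; simp
    · simp only [map_sub, map_sum, map_add, map_smul, LinearMap.sub_apply, LinearMap.sum_apply,
        LinearMap.add_apply, LinearMap.smul_apply, smul_eq_mul, hF.pow_pow, hF.self, hvw, hwv]
      constructor
      · rw [Finset.sum_eq_single (k - i)]
        · rw [if_pos (by omega), show k - (k - i) = i by omega]; ring
        · intro j hj hji
          rw [if_neg (by omega)]; ring
        · intro h; exact absurd (Finset.mem_range.2 (by omega)) h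
      · rw [Finset.sum_eq_single (k - i)]
        · rw [if_pos (by omega), show k - (k - i) = i by omega]; ring
        · intro j hj hji
          rw [if_neg (by omega)]; ring
        · intro h; exact absurd (Finset.mem_range.2 (by omega)) h
  have hgrd : ∀ (i q : ℕ) (u z : V), G.P q z = z → G.ω u z = 0 → G.ω (G.P i u) z = 0 := by
    intro i q u z hz h0
    by_cases h : i + q = n + 1
    · rw [G.om_P hz h, h0]
    · exact G.om_P' hz h u
  obtain ⟨T, hT, a, vv, h1, h2, h3, h4, h5, h6, h7⟩ := ih (finrank ℂ U')
    (by rw [← hUm]; exact Submodule.finrank_lt_finrank_of_lt hU'lt) U' rfl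
    (fun i u hu => ⟨hUP _ _ hu.1, fun j => ⟨hgrd _ _ _ _ (hF.hom_pow hvα j) (hu.2 j).1,
      hgrd _ _ _ _ (hF.hom_pow hwβ j) (hu.2 j).2⟩⟩)
    (fun u hu => ⟨hUF _ hu.1, fun j => by
      rw [hF.sa, hF.sa, ← Module.End.mul_apply, ← pow_succ', ← Module.End.mul_apply, ← pow_succ']
      exact hu.2 (j + 1)⟩)
    (fun u hu h => hUn u hu.1 fun w' hw' => by
      obtain ⟨u', hu', c, e, he⟩ := hproj w' hw'
      rw [he, map_add, h u' hu', map_sum]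
      simp [(hu.2 _).1, (hu.2 _).2])
  have hz : ∀ t b b' (k : ℕ), G.ω ((F ^ k) (bif b then w else v)) (vv t b') = 0 := by
    intro t b b' k
    rw [G.alt]
    cases b
    · exact neg_eq_zero.2 ((h1 t b').2 k).1
    · exact neg_eq_zero.2 ((h1 t b').2 k).2
  refine ⟨Option T, inferInstance, fun t b => t.elim (bif b then β else α) (fun t => a t b),
    fun t b => t.elim (bif b then w else v) (fun t => vv t b), ?_, ?_, ?_, ?_, ?_, ?_, ?_⟩
  · rintro (_ | t) b
    · cases b
      · exact hvU
      · exact hwU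
    · exact hU'U (h1 t b)
  · rintro (_ | t) b
    · cases b
      · exact hα1
      · simp only [Option.elim, cond_true]; omega
    · exact h2 t b
  · rintro (_ | t)
    · simp only [Option.elim, cond_true, cond_false]; omega
    · exact h3 t
  · rintro (_ | t) b
    · cases b
      · exact hvα
      · exact hwβ
    · exact h4 t b
  · rintro (_ | t) (_ | t') b b' htt k
    · exact absurd rfl htt
    · exact hz t' b b' k
    · simp only [Option.elim]
      rw [hF.swap]
      exact neg_eq_zero.2 (hz t b' b k)
    · exact h5 t t' b b' (fun h => htt (by rw [h])) k
  · rintro (_ | t) h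
    · simp only [Option.elim, cond_true, cond_false]
      rw [show n + 1 - (α + β) = k by omega, hw]
    · exact h6 t h
  · intro u hu
    obtain ⟨u', hu', c, e, he⟩ := hproj u hu
    rw [he]
    refine Submodule.add_mem _ ?_ (Submodule.sum_mem _ fun j _ => Submodule.add_mem _
      (Submodule.smul_mem _ _ (Submodule.subset_span ⟨((none, false), j), rfl⟩))
      (Submodule.smul_mem _ _ (Submodule.subset_span ⟨((none, true), j), rfl⟩)))
    refine Submodule.span_mono ?_ (h7 hu')
    rintro _ ⟨i, rfl⟩
    exact ⟨((some i.1.1, i.1.2), i.2), rfl⟩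

lemma decomp [FiniteDimensional ℂ V] (hF : G.IsOp F) :
    ∃ (T : Type) (_ : Fintype T) (a : T → Bool → ℕ) (v : T → Bool → V),
      Adp G F a v ∧ ∀ t, a t false + a t true ≤ n + 1 := by
  classical
  obtain ⟨T, hT, a, v, -, h2, h3, h4, h5, h6, h7⟩ := decomp_aux hF (finrank ℂ (⊤ : Submodule ℂ V))
    ⊤ rfl (fun _ _ _ => trivial) (fun _ _ => trivial) (fun u _ h => G.nd u fun w => h w trivial)
  refine ⟨T, hT, a, v, ⟨h2, fun t => (h3 t).trans (by omega), h4, h5, h6, ?_⟩, h3⟩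
  have hzero : ∀ (s : T × Bool) (k : ℕ), n + 2 ≤ a s.1 s.2 + a s.1 (!s.2) + k →
      (F ^ k) (v s.1 s.2) = 0 := by
    intro s k hk
    apply G.nd
    intro w
    have hw := h7 (Submodule.mem_top (x := w))
    induction hw using Submodule.span_induction with
    | mem x hx =>
      obtain ⟨i, rfl⟩ := hx
      have hp := pairing hF h4 h5 h6 s i.1 k i.2
      simp only
      rw [hp, if_neg (by rintro ⟨g1, g2⟩; omega)]
    | zero => simp
    | add x y _ _ hx hy => rw [map_add, hx, hy, add_zero]
    | smul c x _ hx => rw [map_smul, hx, smul_zero]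
  have li := vec_li (a := a) hF h4 h5 h6
  have hsp : ⊤ ≤ Submodule.span ℂ (Set.range (vec F n a v)) := by
    refine h7.trans ?_
    rw [Submodule.span_le]
    rintro _ ⟨⟨s, k⟩, rfl⟩
    by_cases hk : n + 2 ≤ a s.1 s.2 + a s.1 (!s.2) + k
    · simp only
      rw [hzero s k hk]; exact Submodule.zero_mem _
    · exact Submodule.subset_span ⟨⟨s, ⟨k, by omega⟩⟩, rfl⟩
  rw [← card_Idx, Module.finrank_eq_card_basis (Basis.mk li hsp)]

lemma Adp.flip {T : Type} [Fintype T] {a : T → Bool → ℕ} {v : T → Bool → V} (hF : G.IsOp F)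
    (h : Adp G F a v) (β : T → Bool) : ∃ v', Adp G F (fun t b => a t (b ^^ β t)) v' := by
  refine ⟨fun t b => (if b && β t then (-1 : ℂ) else 1) • v t (b ^^ β t), ?_, ?_, ?_, ?_, ?_, ?_⟩
  · intro t b; exact h.pos _ _
  · intro t
    have := h.le t
    cases hb : β t <;> simp [hb] <;> omega
  · intro t b
    simp only [map_smul, h.hom]
  · intro t t' b b' htt k
    simp only [map_smul, LinearMap.smul_apply, h.orth _ _ _ _ htt, smul_zero]
  · intro t ht
    cases hb : β t
    · simp only [hb] at ht
      simpa using h.one t (by simpa using ht)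
    · simp only [hb, Bool.xor_true, Bool.not_false, Bool.not_true] at ht
      have := h.one t (by omega)
      rw [add_comm (a t false)] at this
      simp only [Bool.and_true, Bool.false_eq_true, if_false, if_true, Bool.xor_true,
        Bool.not_false, Bool.not_true, one_smul, neg_smul, map_neg]
      rw [hF.swap, this, neg_neg]
  · rw [← h.card]
    refine Finset.sum_congr rfl fun t _ => ?_
    cases hb : β t <;> simp [add_comm]

lemma isometry [FiniteDimensional ℂ V] {T : Type} [Fintype T] {a : T → Bool → ℕ}
    {v v' : T → Bool → V} {F' : V →ₗ[ℂ] V} (hF : G.IsOp F) (hF' : G.IsOp F')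
    (h : Adp G F a v) (h' : Adp G F' a v') :
    ∃ g : V ≃ₗ[ℂ] V, (∀ u w, G.ω (g u) (g w) = G.ω u w) ∧ (∀ u, g (F u) = F' (g u)) ∧
      ∀ i u, g (G.P i u) = G.P i (g u) := by
  classical
  obtain ⟨b, hb⟩ := exists_bas hF h
  obtain ⟨b', hb'⟩ := exists_bas hF' h'
  let g := b.equiv b' (Equiv.refl _)
  have hg0 : ∀ i, g (b i) = b' i := fun i => by simp [g]
  have hg : ∀ (s : T × Bool) k, g ((F ^ k) (v s.1 s.2)) = (F' ^ k) (v' s.1 s.2) := by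
    intro s k
    by_cases hk : n + 2 ≤ a s.1 s.2 + a s.1 (!s.2) + k
    · rw [vec_zero hF h s k hk, vec_zero hF' h' s k hk, map_zero]
    · have := hg0 ⟨s, ⟨k, by omega⟩⟩
      rwa [hb, hb'] at this
  refine ⟨g, ?_, ?_, ?_⟩
  · have : (G.ω.compl₁₂ g.toLinearMap g.toLinearMap) = G.ω := by
      refine b.ext fun i => b.ext fun j => ?_
      simp only [LinearMap.compl₁₂_apply, LinearEquiv.coe_coe]
      rw [hb, hb]
      unfold vec
      rw [hg, hg, pairing hF h.hom h.orth h.one, pairing hF' h'.hom h'.orth h'.one]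
    intro u w
    exact LinearMap.congr_fun (LinearMap.congr_fun this u) w
  · have : g.toLinearMap ∘ₗ F = F' ∘ₗ g.toLinearMap := by
      refine b.ext fun i => ?_
      simp only [LinearMap.comp_apply, LinearEquiv.coe_coe]
      rw [hb]
      unfold vec
      rw [hg, ← Module.End.mul_apply, ← pow_succ', hg, pow_succ']; rfl
    exact fun u => LinearMap.congr_fun this u
  · intro i
    have : g.toLinearMap ∘ₗ (G.P i) = (G.P i) ∘ₗ g.toLinearMap := by
      refine b.ext fun j => ?_
      simp only [LinearMap.comp_apply, LinearEquiv.coe_coe]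
      rw [hb]
      unfold vec
      rw [hg]
      have e1 := hF.hom_pow (h.hom j.1.1 j.1.2) j.2
      have e2 := hF'.hom_pow (h'.hom j.1.1 j.1.2) j.2
      by_cases hi : i = a j.1.1 j.1.2 + j.2
      · rw [hi, e1, e2, hg]
      · rw [G.hom_ne e1 hi, G.hom_ne e2 hi, map_zero]
    exact fun u => LinearMap.congr_fun this u

end OrbC

namespace OrbC
variable {n : ℕ} {V : Type} [AddCommGroup V] [Module ℂ V]
variable {G : GSys n V} {F : V →ₗ[ℂ] V}

/-- rank two selfadjoint perturbation -/
noncomputable def pert (G : GSys n V) (y z : V) : V →ₗ[ℂ] V :=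
  (G.ω.flip y).smulRight z - (G.ω.flip z).smulRight y

lemma pert_apply (G : GSys n V) (y z X : V) : pert G y z X = G.ω X y • z - G.ω X z • y := by
  simp [pert]

lemma isOp_pert (hF : G.IsOp F) {p q : ℕ} {y z : V} (hy : G.P p y = y) (hz : G.P q z = z)
    (hpq : p + q = n + 2) (hp : 1 ≤ p) (hq : 1 ≤ q) (τ : ℂ) : G.IsOp (F + τ • pert G y z) := by
  constructor
  · intro i v
    have key : pert G y z (G.P i v) = G.P (i + 1) (pert G y z v) := by
      rw [pert_apply, pert_apply, map_sub, map_smul, map_smul]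
      congr 1
      · by_cases h : i + 1 = q
        · rw [h, hz, G.om_P hy (by omega)]
        · rw [G.hom_ne hz h, G.om_P' hy (by omega), smul_zero, zero_smul]
      · by_cases h : i + 1 = p
        · rw [h, hy, G.om_P hz (by omega)]
        · rw [G.hom_ne hy h, G.om_P' hz (by omega), smul_zero, zero_smul]
    simp only [LinearMap.add_apply, LinearMap.smul_apply, map_add, map_smul, hF.deg, key]
  · intro v w
    simp only [LinearMap.add_apply, LinearMap.smul_apply, map_add, map_smul, hF.sa, pert_apply,
      map_sub, LinearMap.sub_apply, smul_eq_mul]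
    rw [G.alt z w, G.alt y w]
    ring

lemma pow_eq_of (F A : V →ₗ[ℂ] V) (τ : ℂ) (u : V) (k : ℕ) (h : ∀ i < k, A ((F ^ i) u) = 0) :
    ((F + τ • A) ^ k) u = (F ^ k) u := by
  induction k with
  | zero => simp
  | succ k ih =>
    rw [pow_succ', Module.End.mul_apply, ih (fun i hi => h i (by omega)), LinearMap.add_apply,
      LinearMap.smul_apply, h k (by omega), smul_zero, add_zero, pow_succ', Module.End.mul_apply]

/-- new starting degrees -/
def swp {T : Type} [DecidableEq T] (a : T → Bool → ℕ) (s t : T) : T → Bool → ℕ := fun r b =>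
  bif b then (if r = s then a t true else if r = t then a s true else a r true) else a r false

set_option maxHeartbeats 1000000 in
lemma swap_adp [FiniteDimensional ℂ V] {T : Type} [Fintype T] [DecidableEq T] {a : T → Bool → ℕ}
    {v : T → Bool → V} (hF : G.IsOp F) (h : Adp G F a v) (s t : T) (hst : s ≠ t)
    (hx : a s false < a t false) (hy : a t true < a s true)
    (hxy : a t false + a s true ≤ n + 2) (hs : a s false + a s true ≤ n + 1) :
    ∃ A : V →ₗ[ℂ] V, (∀ τ : ℂ, G.IsOp (F + τ • A)) ∧
      ∀ τ : ℂ, τ ≠ 0 → ∃ v', Adp G (F + τ • A) (swp a s t) v' := by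
  set x := a s false with hxd
  set x' := a t false with hx'd
  set y := a s true with hyd
  set y' := a t true with hy'd
  have hsx := h.pos s false
  have hsy := h.pos s true
  have htx := h.pos t false
  have hty := h.pos t true
  set c := n + 2 - y - x' with hc
  set z := (F ^ c) (v t false) with hz
  set A := pert G (v s true) z with hA
  have hzP : G.P (n + 2 - y) z = z := by
    have := hF.hom_pow (h.hom t false) c
    rwa [show a t false + c = n + 2 - y by omega] at this
  have hop : ∀ τ : ℂ, G.IsOp (F + τ • A) := fun τ =>
    isOp_pert hF (h.hom s true) hzP (by omega) (by omega) (by omega) τ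
  refine ⟨A, hop, fun τ hτ => ?_⟩
  have hK := hop τ
  set K := F + τ • A with hKd
  have z0 : ∀ (r : T) b, r ≠ t → ∀ i, G.ω ((F ^ i) (v r b)) z = 0 := by
    intro r b hr i
    rw [hz, hF.pow_pow]; exact h.orth _ _ _ _ hr _
  -- powers of K on old generators
  have Kvt : ∀ k, (K ^ k) (v t false) = (F ^ k) (v t false) := fun k =>
    pow_eq_of _ _ _ _ _ fun i _ => by
      rw [hA, pert_apply, h.orth _ _ _ _ hst.symm, hz, hF.pow_pow, hF.self]; simp
  have Kr : ∀ r, r ≠ s → r ≠ t → ∀ b k, (K ^ k) (v r b) = (F ^ k) (v r b) := fun r hrs hrt b k =>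
    pow_eq_of _ _ _ _ _ fun i _ => by
      rw [hA, pert_apply, h.orth _ _ _ _ hrs, z0 r b hrt]; simp
  set m := y - y' with hm
  have Kwt : ∀ k, (K ^ k) ((F ^ m) (v t true)) = (F ^ (k + m)) (v t true) := by
    intro k
    rw [pow_add, Module.End.mul_apply]
    refine pow_eq_of _ _ _ _ _ fun i _ => ?_
    have e : (F ^ i) ((F ^ m) (v t true)) = (F ^ (i + m)) (v t true) := by rw [pow_add]; rfl
    rw [e, hA, pert_apply, h.orth _ _ _ _ hst.symm,
      G.om_hom (hF.hom_pow (h.hom t true) _) hzP (by omega)]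
    simp
  set l := n + 1 - (x + y) with hl
  have Kvs0 : (K ^ l) (v s false) = (F ^ l) (v s false) :=
    pow_eq_of _ _ _ _ _ fun i hi => by
      rw [hA, pert_apply, z0 s false hst, G.om_hom (hF.hom_pow (h.hom s false) _) (h.hom s true)
        (by omega)]
      simp
  have Kvs1 : (K ^ (l + 1)) (v s false) = τ • z := by
    rw [pow_succ', Module.End.mul_apply, Kvs0, hKd, LinearMap.add_apply, ← Module.End.mul_apply,
      ← pow_succ', vec_zero hF h (s, false) (l + 1) (by simp only [Bool.not_false]; omega),
      zero_add, LinearMap.smul_apply, hA, pert_apply, h.one s hs, z0 s false hst]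
    simp
  have Kvs : ∀ j, (K ^ (l + 1 + j)) (v s false) = τ • (F ^ (j + c)) (v t false) := by
    intro j
    rw [add_comm (l + 1), pow_add, Module.End.mul_apply, Kvs1, map_smul, hz, ← Kvt c,
      ← Module.End.mul_apply, ← pow_add, Kvt]
  set e := x' - x with he
  -- the new generators
  have T1 : ∀ k, G.ω ((K ^ k) (v s false)) (v t false - τ⁻¹ • (K ^ e) (v s false)) = 0 := by
    intro k
    rw [map_sub, map_smul, hK.pow_pow, hK.self, hK.swap, Kvt, h.orth _ _ _ _ hst.symm]
    simp
  have T2 : ∀ k, G.ω ((K ^ k) (v s false)) ((F ^ m) (v t true)) = 0 := by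
    intro k
    rw [hK.swap, Kwt, h.orth _ _ _ _ hst.symm, neg_zero]
  have hehom : G.P x' (v t false - τ⁻¹ • (K ^ e) (v s false)) =
      v t false - τ⁻¹ • (K ^ e) (v s false) := by
    rw [map_sub, map_smul]
    have := hK.hom_pow (h.hom s false) e
    rw [show a s false + e = x' by omega] at this
    rw [this, h.hom t false]
  have T3 : ∀ k, G.ω ((K ^ k) (v t false - τ⁻¹ • (K ^ e) (v s false))) (v t true) = 0 := by
    intro k
    by_cases hk : x' + k + y' = n + 1
    · rw [map_sub, map_smul, Kvt, ← Module.End.mul_apply, ← pow_add,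
        show k + e = l + 1 + (y - y' - 1) by omega, Kvs, smul_smul, inv_mul_cancel₀ hτ, one_smul,
        show y - y' - 1 + c = k by omega, sub_self]
      simp
    · exact G.om_hom (hK.hom_pow hehom k) (h.hom t true) hk
  have T4 : ∀ k, G.ω ((K ^ k) (v t true)) ((F ^ m) (v t true)) = 0 := by
    intro k
    rw [hK.swap, Kwt, hF.self, neg_zero]
  have T5 : ∀ r, r ≠ s → r ≠ t → ∀ b k,
      G.ω ((K ^ k) (v r b)) (v t false - τ⁻¹ • (K ^ e) (v s false)) = 0 := by
    intro r hrs hrt b k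
    rw [map_sub, map_smul, hK.pow_pow, Kr r hrs hrt, Kr r hrs hrt, h.orth _ _ _ _ hrs,
      h.orth _ _ _ _ hrt]
    simp
  have T6 : ∀ r, r ≠ s → r ≠ t → ∀ b k, G.ω ((K ^ k) (v r b)) ((F ^ m) (v t true)) = 0 := by
    intro r hrs hrt b k
    rw [Kr r hrs hrt, hF.pow_pow, h.orth _ _ _ _ hrt]
  let v' : T → Bool → V := fun r b =>
    if r = s then (bif b then τ⁻¹ • v t true else v s false)
    else if r = t then (bif b then (F ^ m) (v t true) else v t false - τ⁻¹ • (K ^ e) (v s false))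
    else v r b
  have v's0 : v' s false = v s false := by simp [v']
  have v's1 : v' s true = τ⁻¹ • v t true := by simp [v']
  have v't0 : v' t false = v t false - τ⁻¹ • (K ^ e) (v s false) := by simp [v', hst.symm]
  have v't1 : v' t true = (F ^ m) (v t true) := by simp [v', hst.symm]
  have v'r : ∀ r, r ≠ s → r ≠ t → ∀ b, v' r b = v r b := by
    intro r h1 h2 b; simp [v', h1, h2]
  have as0 : swp a s t s false = x := by simp [swp, hxd]
  have as1 : swp a s t s true = y' := by simp [swp, hy'd]
  have at0 : swp a s t t false = x' := by simp [swp, hx'd]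
  have at1 : swp a s t t true = y := by simp [swp, hst.symm, hyd]
  have ar : ∀ r, r ≠ s → r ≠ t → ∀ b, swp a s t r b = a r b := by
    intro r h1 h2 b; cases b <;> simp [swp, h1, h2]
  have Ost : ∀ b b' k, G.ω ((K ^ k) (v' s b)) (v' t b') = 0 := by
    intro b b' k
    cases b <;> cases b'
    · rw [v's0, v't0]; exact T1 k
    · rw [v's0, v't1]; exact T2 k
    · rw [v's1, v't0, map_smul, map_smul, LinearMap.smul_apply, hK.swap, T3]; simp
    · rw [v's1, v't1, map_smul, map_smul, LinearMap.smul_apply, T4]; simp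
  have Ors : ∀ r, r ≠ s → r ≠ t → ∀ b b' k, G.ω ((K ^ k) (v' r b)) (v' s b') = 0 := by
    intro r hrs hrt b b' k
    rw [v'r r hrs hrt, Kr r hrs hrt]
    cases b'
    · rw [v's0]; exact h.orth _ _ _ _ hrs _
    · rw [v's1, map_smul, h.orth _ _ _ _ hrt, smul_zero]
  have Ort : ∀ r, r ≠ s → r ≠ t → ∀ b b' k, G.ω ((K ^ k) (v' r b)) (v' t b') = 0 := by
    intro r hrs hrt b b' k
    rw [v'r r hrs hrt]
    cases b'
    · rw [v't0]; exact T5 r hrs hrt b k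
    · rw [v't1]; exact T6 r hrs hrt b k
  refine ⟨v', ?_, ?_, ?_, ?_, ?_, ?_⟩
  · intro r b
    by_cases hrs : r = s
    · subst hrs
      cases b
      · rw [as0]; omega
      · rw [as1]; omega
    · by_cases hrt : r = t
      · subst hrt
        cases b
        · rw [at0]; omega
        · rw [at1]; omega
      · rw [ar r hrs hrt]; exact h.pos r b
  · intro r
    by_cases hrs : r = s
    · subst hrs
      rw [as0, as1]; omega
    · by_cases hrt : r = t
      · subst hrt
        rw [at0, at1]; omega
      · rw [ar r hrs hrt, ar r hrs hrt]; exact h.le r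
  · intro r b
    by_cases hrs : r = s
    · subst hrs
      cases b
      · rw [as0, v's0]; exact h.hom _ _
      · rw [as1, v's1, map_smul, h.hom]
    · by_cases hrt : r = t
      · subst hrt
        cases b
        · rw [at0, v't0]; exact hehom
        · rw [at1, v't1]
          have := hF.hom_pow (h.hom r true) m
          rwa [show a r true + m = y by omega] at this
      · rw [ar r hrs hrt, v'r r hrs hrt]; exact h.hom r b
  · intro r r' b b' hrr k
    by_cases hrs : r = s
    · subst hrs
      by_cases hrt' : r' = t
      · subst hrt'; exact Ost b b' k
      · rw [hK.swap, Ors r' hrr.symm hrt', neg_zero]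
    · by_cases hrt : r = t
      · subst hrt
        by_cases hrs' : r' = s
        · subst hrs'; rw [hK.swap, Ost, neg_zero]
        · rw [hK.swap, Ort r' hrs' hrr.symm, neg_zero]
      · by_cases hrs' : r' = s
        · subst hrs'; exact Ors r hrs hrt b b' k
        · by_cases hrt' : r' = t
          · subst hrt'; exact Ort r hrs hrt b b' k
          · rw [v'r r hrs hrt, v'r r' hrs' hrt', Kr r hrs hrt]; exact h.orth _ _ _ _ hrr _
  · intro r hr
    by_cases hrs : r = s
    · subst hrs
      rw [as0, as1, v's0, v's1, show n + 1 - (x + y') = l + 1 + (y - y' - 1) by omega, Kvs]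
      have := h.one t (by omega)
      rw [show y - y' - 1 + c = n + 1 - (a t false + a t true) by omega]
      simp only [map_smul, LinearMap.smul_apply, this, smul_eq_mul, mul_one]
      exact inv_mul_cancel₀ hτ
    · by_cases hrt : r = t
      · subst hrt
        rw [at0, at1] at hr
        rw [at0, at1, v't0, v't1, map_sub, map_smul, map_sub, map_smul, LinearMap.sub_apply,
          LinearMap.smul_apply, ← Module.End.mul_apply, ← pow_add, T2, smul_zero, sub_zero, Kvt,
          hF.pow_pow]
        have := h.one r (by omega)
        rwa [show n + 1 - (x' + y) + m = n + 1 - (a r false + a r true) by omega]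
      · rw [ar r hrs hrt, ar r hrs hrt] at hr ⊢
        rw [v'r r hrs hrt, v'r r hrs hrt, Kr r hrs hrt]
        exact h.one r hr
  · rw [← h.card]
    rw [← Finset.add_sum_erase _ _ (Finset.mem_univ s),
      ← Finset.add_sum_erase _ _ (Finset.mem_erase.2 ⟨hst.symm, Finset.mem_univ t⟩)]
    rw [← Finset.add_sum_erase Finset.univ (fun r => 2 * (n + 2 - (a r false + a r true)))
        (Finset.mem_univ s),
      ← Finset.add_sum_erase _ _ (Finset.mem_erase.2 ⟨hst.symm, Finset.mem_univ t⟩)]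
    have : ∑ r ∈ (Finset.univ.erase s).erase t,
        2 * (n + 2 - (swp a s t r false + swp a s t r true)) =
        ∑ r ∈ (Finset.univ.erase s).erase t, 2 * (n + 2 - (a r false + a r true)) := by
      refine Finset.sum_congr rfl fun r hr' => ?_
      simp only [Finset.mem_erase, Finset.mem_univ, and_true] at hr'
      simp only [ar r hr'.2 hr'.1]
    rw [this, as0, as1, at0, at1]
    have := h.le t
    omega

/-- Equal counting functions give an isomorphism of normalised systems. -/
lemma exists_equiv {T T' : Type} [Fintype T] [Fintype T'] (a : T → Bool → ℕ) (a' : T' → Bool → ℕ)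
    (h1 : ∀ t b, 1 ≤ a t b) (h1' : ∀ t b, 1 ≤ a' t b)
    (h2 : ∀ t, a t false + a t true ≤ n + 1) (h2' : ∀ t, a' t false + a' t true ≤ n + 1)
    (h3 : ∀ t, a t false ≤ a t true) (h3' : ∀ t, a' t false ≤ a' t true)
    (hR : ∀ p q, p + q ≤ n + 1 → RR a p q = RR a' p q) :
    ∃ φ : T ≃ T', ∀ t b, a' (φ t) b = a t b := by
  classical
  have count : ∀ {T : Type} [Fintype T] (a : T → Bool → ℕ) (_ : ∀ t, a t false ≤ a t true)
      (x y : ℕ), 1 ≤ x → 1 ≤ y → x ≤ y →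
      RR a x y - RR a x (y - 1) - RR a (x - 1) y + RR a (x - 1) (y - 1) =
      (if x = y then 2 else 1) * (Fintype.card {t // (a t false, a t true) = (x, y)} : ℤ) := by
    intro T _ a h3 x y hx hy hxy
    rw [RR_box a (by omega) (by omega), Fintype.card_subtype, ← Finset.sum_boole, Finset.mul_sum,
      Fintype.sum_prod_type]
    refine Finset.sum_congr rfl fun t _ => ?_
    have := h3 t
    simp only [Fintype.sum_bool, Bool.not_true, Bool.not_false, Prod.mk.injEq]
    split_ifs <;> omega
  have hcard : ∀ xy : ℕ × ℕ, Fintype.card {t // (a t false, a t true) = xy} =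
      Fintype.card {t // (a' t false, a' t true) = xy} := by
    rintro ⟨x, y⟩
    by_cases hxy : 1 ≤ x ∧ x ≤ y ∧ x + y ≤ n + 1
    · obtain ⟨g1, g2, g3⟩ := hxy
      have e1 := count a h3 x y g1 (by omega) g2
      have e2 := count a' h3' x y g1 (by omega) g2
      rw [hR _ _ (by omega), hR _ _ (by omega), hR _ _ (by omega), hR _ _ (by omega), e2] at e1
      split_ifs at e1 <;> omega
    · have i1 : IsEmpty {t // (a t false, a t true) = (x, y)} := ⟨fun ⟨t, ht⟩ => hxy (by
        rw [Prod.mk.injEq] at ht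
        have := h1 t false; have := h2 t; have := h3 t
        omega)⟩
      have i2 : IsEmpty {t // (a' t false, a' t true) = (x, y)} := ⟨fun ⟨t, ht⟩ => hxy (by
        rw [Prod.mk.injEq] at ht
        have := h1' t false; have := h2' t; have := h3' t
        omega)⟩
      rw [Fintype.card_eq_zero, Fintype.card_eq_zero]
  let φ := Equiv.ofFiberEquiv (f := fun t => (a t false, a t true))
    (g := fun t => (a' t false, a' t true)) (fun xy => Fintype.equivOfCardEq (hcard xy))
  refine ⟨φ, fun t b => ?_⟩
  have := Equiv.ofFiberEquiv_map (f := fun t => (a t false, a t true))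
    (g := fun t => (a' t false, a' t true)) (fun xy => Fintype.equivOfCardEq (hcard xy)) t
  rw [Prod.mk.injEq] at this
  cases b
  · exact this.1
  · exact this.2

lemma Adp.reindex {T T' : Type} [Fintype T] [Fintype T'] {a : T → Bool → ℕ} {a' : T' → Bool → ℕ}
    {v' : T' → Bool → V} (h : Adp G F a' v') (φ : T ≃ T') (hφ : ∀ t b, a' (φ t) b = a t b) :
    Adp G F a (fun t b => v' (φ t) b) := by
  refine ⟨?_, ?_, ?_, ?_, ?_, ?_⟩
  · intro t b; rw [← hφ]; exact h.pos _ _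
  · intro t; rw [← hφ, ← hφ]; exact h.le _
  · intro t b; rw [← hφ]; exact h.hom _ _
  · intro t t' b b' htt k; exact h.orth _ _ _ _ (fun e => htt (φ.injective e)) k
  · intro t ht; rw [← hφ, ← hφ] at ht ⊢; exact h.one _ ht
  · rw [← h.card, ← φ.sum_comp]
    simp only [hφ]

lemma RR_flip {T : Type} [Fintype T] (a : T → Bool → ℕ) (β : T → Bool) (p q : ℕ) :
    RR (fun t b => a t (b ^^ β t)) p q = RR a p q := by
  unfold RR
  rw [Fintype.sum_prod_type, Fintype.sum_prod_type]
  refine Finset.sum_congr rfl fun t _ => ?_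
  cases hb : β t <;> simp only [Fintype.sum_bool, hb, Bool.xor_false, Bool.xor_true, Bool.not_true, Bool.not_false]
  rw [add_comm]

/-- Abstract main theorem. -/
lemma abstract_main [FiniteDimensional ℂ V] {M : V →ₗ[ℂ] V} (hM : G.IsOp M)
    (C : (V →ₗ[ℂ] V) → Prop)
    (hC1 : ∀ N, G.IsOp N → (∃ g : V ≃ₗ[ℂ] V, (∀ u w, G.ω (g u) (g w) = G.ω u w) ∧
      (∀ u, g (M u) = N (g u)) ∧ ∀ i u, g (G.P i u) = G.P i (g u)) → C N)
    (hC2 : ∀ N A, G.IsOp N → (∀ τ : ℂ, τ ≠ 0 → G.IsOp (N + τ • A) ∧ C (N + τ • A)) → C N)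
    (N : V →ₗ[ℂ] V) (hN : G.IsOp N)
    (hle : ∀ p q, 1 ≤ p → 1 ≤ q → p + q ≤ n + 1 →
      finrank ℂ (LinearMap.range ((N ^ (n + 1 - p - q)) ∘ₗ G.P p)) ≤
      finrank ℂ (LinearMap.range ((M ^ (n + 1 - p - q)) ∘ₗ G.P p))) : C N := by
  classical
  obtain ⟨T', _, a', v', hAM, hM2⟩ := decomp hM
  have hRM := rank_formula hM hAM
  -- induction on the total defect
  suffices H : ∀ (m : ℕ) (N : V →ₗ[ℂ] V), G.IsOp N →
      (∀ p q, p + q ≤ n + 1 →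
        (finrank ℂ (LinearMap.range ((N ^ (n + 1 - p - q)) ∘ₗ G.P p)) : ℤ) ≤ RR a' p q) →
      (∑ p ∈ Finset.range (n + 2), ∑ q ∈ Finset.range (n + 2 - p), (RR a' p q -
        (finrank ℂ (LinearMap.range ((N ^ (n + 1 - p - q)) ∘ₗ G.P p)) : ℤ))).toNat = m → C N by
    refine H _ N hN (fun p q hpq => ?_) rfl
    obtain ⟨T, _, a, v, hAN, hN2⟩ := decomp hN
    rw [rank_formula hN hAN p q hpq]
    rcases Nat.eq_zero_or_pos p with rfl | hp
    · rw [RR_zero a hAN.pos, RR_zero a' hAM.pos]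
    · rcases Nat.eq_zero_or_pos q with rfl | hq
      · rw [RR_symm a, RR_symm a', RR_zero a hAN.pos, RR_zero a' hAM.pos]
      · rw [← rank_formula hN hAN p q hpq, ← hRM p q hpq]
        exact_mod_cast hle p q hp hq hpq
  intro m
  induction m using Nat.strong_induction_on with
  | _ m ih =>
  intro N hN hle hm
  obtain ⟨T, _, a, v, hAN, hN2⟩ := decomp hN
  have hRN := rank_formula hN hAN
  by_cases hall : ∀ p q, p + q ≤ n + 1 → RR a p q = RR a' p q
  · -- same ranks: isometric
    apply hC1 N hN
    let β : T → Bool := fun t => decide (a t true < a t false)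
    let β' : T' → Bool := fun t => decide (a' t true < a' t false)
    obtain ⟨w, hw⟩ := hAN.flip hN β
    obtain ⟨w', hw'⟩ := hAM.flip hM β'
    have n1 : ∀ {S : Type} (a : S → Bool → ℕ) (t : S),
        a t (false ^^ decide (a t true < a t false)) ≤
        a t (true ^^ decide (a t true < a t false)) := by
      intro S a t
      by_cases h : a t true < a t false
      · simp [h]; omega
      · simp [h]; omega
    have n2 : ∀ {S : Type} (a : S → Bool → ℕ) (t : S), a t false + a t true ≤ n + 1 →
        a t (false ^^ decide (a t true < a t false)) +
        a t (true ^^ decide (a t true < a t false)) ≤ n + 1 := by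
      intro S a t h0
      by_cases h : a t true < a t false
      · simp [h]; omega
      · simp [h]; omega
    obtain ⟨φ, hφ⟩ := exists_equiv (n := n) _ _ hw'.pos hw.pos (fun t => n2 a' t (hM2 t))
      (fun t => n2 a t (hN2 t)) (n1 a') (n1 a) (fun p q hpq => by
        rw [RR_flip, RR_flip, hall p q hpq])
    exact isometry hM hN hw' (hw.reindex φ hφ)
  · push Not at hall
    have hbd : ∀ p q, p + q = n + 1 → RR a p q = RR a' p q := by
      intro p q hpq
      rw [← hRN p q (by omega), ← hRM p q (by omega), show n + 1 - p - q = 0 by omega]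
      have e : N ^ 0 = M ^ 0 := by rw [pow_zero, pow_zero]
      rw [e]
    obtain ⟨s, t, hst, hx, hy, hxy, hs, hup⟩ := comb n a a' hAN.pos hAM.pos
      (fun p q hpq => by rw [← hRN p q hpq]; exact hle p q hpq) hbd hall
    -- orient the two arcs
    let β : T → Bool := fun r => if r = s.1 then s.2 else if r = t.1 then t.2 else false
    have hβs : β s.1 = s.2 := by simp [β]
    have hβt : β t.1 = t.2 := by simp [β, hst.symm]
    obtain ⟨w, hw⟩ := hAN.flip hN β
    obtain ⟨b, hb⟩ : ∃ b : T → Bool → ℕ, b = fun r c => a r (c ^^ β r) := ⟨_, rfl⟩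
    rw [← hb] at hw
    have bs0 : b s.1 false = a s.1 s.2 := by simp [hb, hβs]
    have bs1 : b s.1 true = a s.1 (!s.2) := by simp [hb, hβs]
    have bt0 : b t.1 false = a t.1 t.2 := by simp [hb, hβt]
    have bt1 : b t.1 true = a t.1 (!t.2) := by simp [hb, hβt]
    have hRb : ∀ p q, RR b p q = RR a p q := fun p q => by rw [hb, RR_flip]
    rw [← bs0, ← bt0] at hx
    rw [← bs1, ← bt1] at hy
    rw [← bs1, ← bt0] at hxy
    rw [← bs0, ← bs1] at hs
    obtain ⟨A, hA1, hA2⟩ := swap_adp hN hw s.1 t.1 hst hx hy hxy hs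
    refine hC2 N A hN fun τ hτ => ⟨hA1 τ, ?_⟩
    obtain ⟨w', hw'⟩ := hA2 τ hτ
    have hR' := rank_formula (hA1 τ) hw'
    have hsw := RR_swap b (swp b s.1 t.1) s.1 t.1 hst (by simp [swp]) (by simp [swp])
      (by simp [swp]) (by simp [swp, hst.symm])
      (fun r h1 h2 c => by cases c <;> simp [swp, h1, h2]) hx hy
    have hle' : ∀ p q, p + q ≤ n + 1 → RR (swp b s.1 t.1) p q ≤ RR a' p q := by
      intro p q hpq
      rw [hsw, hRb, bs0, bs1, bt0, bt1]
      exact hup p q hpq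
    have hge : ∀ p q, RR b p q ≤ RR (swp b s.1 t.1) p q := by
      intro p q
      rw [hsw]
      split_ifs <;> omega
    have hgt : RR b (b s.1 false) (b t.1 true) < RR (swp b s.1 t.1) (b s.1 false) (b t.1 true) := by
      rw [hsw, if_pos ⟨⟨le_rfl, hx⟩, ⟨le_rfl, hy⟩⟩]
      split_ifs <;> omega
    refine ih _ ?_ (N + τ • A) (hA1 τ) (fun p q hpq => by rw [hR' p q hpq]; exact hle' p q hpq) rfl
    rw [← hm]
    have hlt : ∑ p ∈ Finset.range (n + 2), ∑ q ∈ Finset.range (n + 2 - p), (RR a' p q -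
          (finrank ℂ (LinearMap.range (((N + τ • A) ^ (n + 1 - p - q)) ∘ₗ G.P p)) : ℤ)) <
        ∑ p ∈ Finset.range (n + 2), ∑ q ∈ Finset.range (n + 2 - p), (RR a' p q -
          (finrank ℂ (LinearMap.range ((N ^ (n + 1 - p - q)) ∘ₗ G.P p)) : ℤ)) := by
      have hterm : ∀ p ∈ Finset.range (n + 2), ∀ q ∈ Finset.range (n + 2 - p), (RR a' p q -
          (finrank ℂ (LinearMap.range (((N + τ • A) ^ (n + 1 - p - q)) ∘ₗ G.P p)) : ℤ)) ≤ (RR a' p q -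
          (finrank ℂ (LinearMap.range ((N ^ (n + 1 - p - q)) ∘ₗ G.P p)) : ℤ)) := by
        intro p hp q hq
        rw [Finset.mem_range] at hp hq
        rw [hR' p q (by omega), hRN p q (by omega)]
        have := hge p q
        rw [hRb] at this
        omega
      refine Finset.sum_lt_sum (fun p hp => Finset.sum_le_sum (hterm p hp))
        ⟨b s.1 false, Finset.mem_range.2 (by omega), Finset.sum_lt_sum (hterm _
          (Finset.mem_range.2 (by omega))) ⟨b t.1 true, Finset.mem_range.2 (by omega), ?_⟩⟩
      rw [hR' _ _ (by omega), hRN _ _ (by omega)]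
      rw [hRb] at hgt
      omega
    have hnn : 0 ≤ ∑ p ∈ Finset.range (n + 2), ∑ q ∈ Finset.range (n + 2 - p), (RR a' p q -
          (finrank ℂ (LinearMap.range (((N + τ • A) ^ (n + 1 - p - q)) ∘ₗ G.P p)) : ℤ)) := by
      refine Finset.sum_nonneg fun p hp => Finset.sum_nonneg fun q hq => ?_
      rw [Finset.mem_range] at hp hq
      rw [hR' p q (by omega)]
      have := hle' p q (by omega)
      omega
    omega

end OrbC

namespace OrbC

section Concrete

variable {n : ℕ} {d : ℕ → ℕ}

/-- The total space. -/
abbrev VV (d : ℕ → ℕ) : Type := ∀ i, Fin (d i) → ℂ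

lemma vec_sub {m : ℕ} (h : m = 0) (v : Fin m → ℂ) : v = 0 := by
  subst h; exact Subsingleton.elim _ _

lemma VV_sum (hdn : ∀ i, n < i → d i = 0) (v : VV d) :
    ∑ i ∈ Finset.range (n + 1), Pi.single (M := fun i => Fin (d i) → ℂ) i (v i) = v := by
  funext j
  rw [Finset.sum_apply]
  by_cases hj : j ≤ n
  · rw [Finset.sum_eq_single j]
    · simp
    · intro b _ hb
      rw [Pi.single_eq_of_ne hb.symm]
    · intro h; simp at h; omega
  · rw [vec_sub (hdn j (by omega)) (v j)]
    exact vec_sub (hdn j (by omega)) _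

lemma VV_fin (hdn : ∀ i, n < i → d i = 0) : FiniteDimensional ℂ (VV d) := by
  let L : VV d →ₗ[ℂ] (∀ i : Fin (n + 1), Fin (d i.1) → ℂ) :=
    LinearMap.pi fun i => LinearMap.proj i.1
  refine FiniteDimensional.of_injective L ?_
  intro v w h
  funext j
  by_cases hj : j ≤ n
  · exact congrFun h ⟨j, by omega⟩
  · rw [vec_sub (hdn j (by omega)) (v j), vec_sub (hdn j (by omega)) (w j)]

lemma VV_ext {W : Type} [AddCommGroup W] [Module ℂ W] (hdn : ∀ i, n < i → d i = 0)
    (L L' : VV d →ₗ[ℂ] W)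
    (h : ∀ i (x : Fin (d i) → ℂ), L (Pi.single i x) = L' (Pi.single i x)) (v : VV d) :
    L v = L' v := by
  rw [← VV_sum hdn v, map_sum, map_sum]
  exact Finset.sum_congr rfl fun i _ => h i _

/-- The projections. -/
noncomputable def PPr (d : ℕ → ℕ) (i : ℕ) : VV d →ₗ[ℂ] VV d :=
  LinearMap.single ℂ (fun i => Fin (d i) → ℂ) i ∘ₗ LinearMap.proj i

lemma PPr_apply (i : ℕ) (v : VV d) : PPr d i v = Pi.single i (v i) := rfl

/-- The sign operator. -/
noncomputable def JJ (d : ℕ → ℕ) : VV d →ₗ[ℂ] VV d :=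
  LinearMap.pi fun i => ((-1 : ℂ) ^ i) • LinearMap.proj i

lemma JJ_single (i : ℕ) (x : Fin (d i) → ℂ) :
    JJ d (Pi.single i x) = ((-1 : ℂ) ^ i) • (Pi.single i x : VV d) := by
  funext j
  change ((-1 : ℂ) ^ j) • (Pi.single i x : VV d) j = ((-1 : ℂ) ^ i) • (Pi.single i x : VV d) j
  by_cases h : j = i
  · subst h; rfl
  · rw [Pi.single_eq_of_ne h]; simp

lemma JJ_JJ (v : VV d) : JJ d (JJ d v) = v := by
  funext j
  change ((-1 : ℂ) ^ j) • ((-1 : ℂ) ^ j) • v j = v j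
  rw [smul_smul, ← mul_pow]; simp

/-- The system of the form `B`. -/
noncomputable def mkSys (n : ℕ) (ε : ℂ)
    (hsplit : (Odd n ∧ ε = -1) ∨ (Even n ∧ ε = 1))
    (d : ℕ → ℕ) (hd0 : d 0 = 0) (hdn : ∀ i, n < i → d i = 0)
    (B : (∀ i, Fin (d i) → ℂ) →ₗ[ℂ] (∀ i, Fin (d i) → ℂ) →ₗ[ℂ] ℂ)
    (hnd : ∀ v, (∀ w, B v w = 0) → v = 0)
    (hsym : ∀ v w, B v w = ε * B w v)
    (hgraded : ∀ (i j : ℕ) (v : Fin (d i) → ℂ) (w : Fin (d j) → ℂ), i + j ≠ n + 1 →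
      B (Pi.single i v) (Pi.single j w) = 0) : GSys n (VV d) where
  P := PPr d
  ω := B ∘ₗ JJ d
  PP i v := by simp [PPr_apply]
  PPne i j v h := by simp [PPr_apply, Pi.single_eq_of_ne h]
  sum v := VV_sum hdn v
  P0 v := by rw [PPr_apply, vec_sub hd0 (v 0)]; simp
  Pn i v h := by rw [PPr_apply, vec_sub (hdn i h) (v i)]; simp
  alt v w := by
    revert w
    have key : ∀ i (x : Fin (d i) → ℂ) w,
        (B ∘ₗ JJ d) (Pi.single i x) w = -(B ∘ₗ JJ d) w (Pi.single i x) := by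
      intro i x w
      refine VV_ext hdn ((B ∘ₗ JJ d) (Pi.single i x)) (-(B ∘ₗ JJ d).flip (Pi.single i x)) ?_ w
      intro j y
      simp only [LinearMap.comp_apply, LinearMap.neg_apply, LinearMap.flip_apply, JJ_single,
        map_smul, LinearMap.smul_apply, smul_eq_mul]
      by_cases h : i + j = n + 1
      · rw [hsym (Pi.single i x) (Pi.single j y)]
        have e : (-1 : ℂ) ^ i * ε = -(-1) ^ j := by
          rcases hsplit with ⟨ho, rfl⟩ | ⟨ho, rfl⟩
          · rcases Nat.even_or_odd i with hi | hi
            · have hj : Even j := by grind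
              rw [hi.neg_one_pow, hj.neg_one_pow]; ring
            · have hj : Odd j := by grind
              rw [hi.neg_one_pow, hj.neg_one_pow]; ring
          · rcases Nat.even_or_odd i with hi | hi
            · have hj : Odd j := by grind
              rw [hi.neg_one_pow, hj.neg_one_pow]; ring
            · have hj : Even j := by grind
              rw [hi.neg_one_pow, hj.neg_one_pow]; ring
        rw [← mul_assoc, e]; ring
      · rw [hgraded i j x y h, hgraded j i y x (by omega)]; simp
    intro w
    exact VV_ext hdn ((B ∘ₗ JJ d).flip w) (-(B ∘ₗ JJ d) w) (fun i x => key i x w) v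
  nd v h := by
    have := hnd (JJ d v) h
    rw [← JJ_JJ v, this, map_zero]
  gr i j v w h := by
    simp only [LinearMap.comp_apply, PPr_apply, JJ_single, map_smul, LinearMap.smul_apply,
      hgraded i j _ _ h, smul_zero]

/-- Components of the operator. -/
noncomputable def opC (d : ℕ → ℕ)
    (f : ∀ i, (Fin (d i) → ℂ) →ₗ[ℂ] (Fin (d (i + 1)) → ℂ)) :
    ∀ i, VV d →ₗ[ℂ] (Fin (d i) → ℂ)
  | 0 => 0
  | (i + 1) => f i ∘ₗ LinearMap.proj i

/-- The degree one operator attached to a tuple of structure maps. -/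
noncomputable def opF (d : ℕ → ℕ)
    (f : ∀ i, (Fin (d i) → ℂ) →ₗ[ℂ] (Fin (d (i + 1)) → ℂ)) : VV d →ₗ[ℂ] VV d :=
  LinearMap.pi (opC d f)

lemma opF_succ (f : ∀ i, (Fin (d i) → ℂ) →ₗ[ℂ] (Fin (d (i + 1)) → ℂ)) (v : VV d) (i : ℕ) :
    opF d f v (i + 1) = f i (v i) := rfl

lemma opF_zero (f : ∀ i, (Fin (d i) → ℂ) →ₗ[ℂ] (Fin (d (i + 1)) → ℂ)) (v : VV d) :
    opF d f v 0 = 0 := rfl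

lemma opF_single (f : ∀ i, (Fin (d i) → ℂ) →ₗ[ℂ] (Fin (d (i + 1)) → ℂ)) (i : ℕ)
    (x : Fin (d i) → ℂ) : opF d f (Pi.single i x) = (Pi.single (i + 1) (f i x) : VV d) := by
  funext j
  cases j with
  | zero => rw [opF_zero, Pi.single_eq_of_ne (by omega)]
  | succ j =>
    rw [opF_succ]
    by_cases h : j = i
    · subst h; simp
    · rw [Pi.single_eq_of_ne h, Pi.single_eq_of_ne (by omega), map_zero]

lemma opF_pow_single (f : ∀ i, (Fin (d i) → ℂ) →ₗ[ℂ] (Fin (d (i + 1)) → ℂ)) (i k : ℕ)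
    (x : Fin (d i) → ℂ) :
    (opF d f ^ k) (Pi.single i x) = (Pi.single (i + k) (comps d f i k x) : VV d) := by
  induction k with
  | zero => rfl
  | succ k ih =>
    rw [pow_succ', Module.End.mul_apply, ih, opF_single]; rfl

lemma rk_eq (f : ∀ i, (Fin (d i) → ℂ) →ₗ[ℂ] (Fin (d (i + 1)) → ℂ)) (i j : ℕ) :
    rk d f i j = finrank ℂ (LinearMap.range ((opF d f ^ (j - i)) ∘ₗ PPr d i)) := by
  have e : (opF d f ^ (j - i)) ∘ₗ PPr d i =
      (LinearMap.single ℂ (fun i => Fin (d i) → ℂ) (i + (j - i)) ∘ₗ comps d f i (j - i)) ∘ₗ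
        LinearMap.proj i := by
    ext1 v
    exact opF_pow_single f i (j - i) (v i)
  rw [e, LinearMap.range_comp_of_range_eq_top _
    (LinearMap.range_eq_top.2 (Function.surjective_eval i)), LinearMap.range_comp]
  exact (LinearEquiv.finrank_eq (Submodule.equivMapOfInjective _
    (LinearMap.ker_eq_bot.1 (LinearMap.ker_single ℂ _ _)) _))

variable {ε : ℂ} {hsplit : (Odd n ∧ ε = -1) ∨ (Even n ∧ ε = 1)}
    {hd0 : d 0 = 0} {hdn : ∀ i, n < i → d i = 0}
    {B : (∀ i, Fin (d i) → ℂ) →ₗ[ℂ] (∀ i, Fin (d i) → ℂ) →ₗ[ℂ] ℂ}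
    {hnd : ∀ v, (∀ w, B v w = 0) → v = 0}
    {hsym : ∀ v w, B v w = ε * B w v}
    {hgraded : ∀ (i j : ℕ) (v : Fin (d i) → ℂ) (w : Fin (d j) → ℂ), i + j ≠ n + 1 →
      B (Pi.single i v) (Pi.single j w) = 0}

lemma opF_isOp (f : ∀ i, (Fin (d i) → ℂ) →ₗ[ℂ] (Fin (d (i + 1)) → ℂ))
    (hf : ∀ i, 1 ≤ i → i + 1 ≤ n → ∀ (v : Fin (d i) → ℂ) (w : Fin (d (n - i)) → ℂ),
      B (Pi.single (i + 1) (f i v)) (Pi.single (n - i) w)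
        + B (Pi.single i v) (Pi.single (n - i + 1) (f (n - i) w)) = 0) :
    (mkSys n ε hsplit d hd0 hdn B hnd hsym hgraded).IsOp (opF d f) := by
  constructor
  · intro i v
    change opF d f (PPr d i v) = PPr d (i + 1) (opF d f v)
    rw [PPr_apply, PPr_apply, opF_single, opF_succ]
  · intro v w
    change B (JJ d (opF d f v)) w = B (JJ d v) (opF d f w)
    have key : ∀ i (x : Fin (d i) → ℂ) j (y : Fin (d j) → ℂ),
        B (JJ d (opF d f (Pi.single i x))) (Pi.single j y) =
        B (JJ d (Pi.single i x)) (opF d f (Pi.single j y)) := by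
      intro i x j y
      rw [opF_single, opF_single, JJ_single, JJ_single]
      simp only [map_smul, LinearMap.smul_apply, smul_eq_mul]
      by_cases h : i + 1 + j = n + 1
      · by_cases hi : i = 0
        · subst hi
          rw [vec_sub hd0 x]; simp
        by_cases hj : j = 0
        · subst hj
          rw [vec_sub hd0 y]; simp
        obtain rfl : j = n - i := by omega
        have := hf i (by omega) (by omega) x y
        rw [pow_succ]
        linear_combination (-(-1 : ℂ) ^ i) * this
      · rw [hgraded _ _ _ _ h, hgraded _ _ _ _ (by omega : i + (j + 1) ≠ n + 1)]; simp
    refine VV_ext hdn (B.flip w ∘ₗ JJ d ∘ₗ opF d f) (B.flip (opF d f w) ∘ₗ JJ d) ?_ v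
    intro i x
    exact VV_ext hdn (B (JJ d (opF d f (Pi.single i x)))) (B (JJ d (Pi.single i x)) ∘ₗ opF d f)
      (fun j y => key i x j y) w

end Concrete

end OrbC

namespace OrbC

section Final

variable {d : ℕ → ℕ}

/-- The tuple of matrices of an operator. -/
noncomputable def tup (n : ℕ) (d : ℕ → ℕ) (F : VV d →ₗ[ℂ] VV d) :
    ∀ i : Fin (n - 1), Matrix (Fin (d (i.1 + 2))) (Fin (d (i.1 + 1))) ℂ := fun i =>
  LinearMap.toMatrix' ((LinearMap.proj (i.1 + 2) : VV d →ₗ[ℂ] (Fin (d (i.1 + 2)) → ℂ)) ∘ₗ F ∘ₗ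
    LinearMap.single ℂ (fun i => Fin (d i) → ℂ) (i.1 + 1))

lemma tup_opF (n : ℕ) (f : ∀ i, (Fin (d i) → ℂ) →ₗ[ℂ] (Fin (d (i + 1)) → ℂ)) :
    tup n d (opF d f) = fun i : Fin (n - 1) => LinearMap.toMatrix' (f (i.1 + 1)) := by
  funext i
  unfold tup
  congr 1
  refine LinearMap.ext fun y => ?_
  change opF d f (Pi.single (i.1 + 1) y) (i.1 + 2) = _
  rw [opF_single, Pi.single_eq_same]

lemma tup_add (n : ℕ) (N A : VV d →ₗ[ℂ] VV d) (τ : ℂ) :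
    tup n d (N + τ • A) = tup n d N + τ • tup n d A := by
  funext i
  simp only [tup, Pi.add_apply, Pi.smul_apply, ← map_smul, ← map_add]
  rfl

/-- The graded pieces of a graded automorphism. -/
noncomputable def grE (g : VV d ≃ₗ[ℂ] VV d) (h1 : ∀ i u, g (PPr d i u) = PPr d i (g u))
    (h2 : ∀ i u, g.symm (PPr d i u) = PPr d i (g.symm u)) (i : ℕ) :
    (Fin (d i) → ℂ) ≃ₗ[ℂ] (Fin (d i) → ℂ) :=
  LinearEquiv.ofLinearMap
    ((LinearMap.proj i : VV d →ₗ[ℂ] (Fin (d i) → ℂ)) ∘ₗ g.toLinearMap ∘ₗ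
      LinearMap.single ℂ (fun i => Fin (d i) → ℂ) i)
    ((LinearMap.proj i : VV d →ₗ[ℂ] (Fin (d i) → ℂ)) ∘ₗ g.symm.toLinearMap ∘ₗ
      LinearMap.single ℂ (fun i => Fin (d i) → ℂ) i)
    (by
      refine LinearMap.ext fun y => ?_
      change g (Pi.single i (g.symm (Pi.single i y) i)) i = y
      rw [← PPr_apply, h1, PPr_apply, LinearEquiv.apply_symm_apply, Pi.single_eq_same,
        Pi.single_eq_same])
    (by
      refine LinearMap.ext fun y => ?_
      change g.symm (Pi.single i (g (Pi.single i y) i)) i = y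
      rw [← PPr_apply, h2, PPr_apply, LinearEquiv.symm_apply_apply, Pi.single_eq_same,
        Pi.single_eq_same])

lemma grE_single (g : VV d ≃ₗ[ℂ] VV d) (h1 : ∀ i u, g (PPr d i u) = PPr d i (g u))
    (h2 : ∀ i u, g.symm (PPr d i u) = PPr d i (g.symm u)) (i : ℕ) (x : Fin (d i) → ℂ) :
    g (Pi.single i x) = (Pi.single i (grE g h1 h2 i x) : VV d) := by
  change _ = (Pi.single i (g (Pi.single i x) i) : VV d)
  have := h1 i (Pi.single i x)
  rw [PPr_apply, PPr_apply, Pi.single_eq_same] at this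
  exact this

/-- Extension of a tuple of matrices to structure maps. -/
noncomputable def xf (n : ℕ) (d : ℕ → ℕ)
    (x : ∀ i : Fin (n - 1), Matrix (Fin (d (i.1 + 2))) (Fin (d (i.1 + 1))) ℂ) :
    ∀ i, (Fin (d i) → ℂ) →ₗ[ℂ] (Fin (d (i + 1)) → ℂ)
  | 0 => 0
  | (j + 1) => if h : j < n - 1 then Matrix.toLin' (x ⟨j, h⟩) else 0

lemma xf_succ (n : ℕ) (d : ℕ → ℕ)
    (x : ∀ i : Fin (n - 1), Matrix (Fin (d (i.1 + 2))) (Fin (d (i.1 + 1))) ℂ) (j : ℕ)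
    (h : j < n - 1) : xf n d x (j + 1) = Matrix.toLin' (x ⟨j, h⟩) := by
  simp [xf, h]

lemma xf_cont (n : ℕ) (d : ℕ → ℕ) (i : ℕ) {X : Type} [TopologicalSpace X]
    (x : X → ∀ i : Fin (n - 1), Matrix (Fin (d (i.1 + 2))) (Fin (d (i.1 + 1))) ℂ)
    (v : X → Fin (d i) → ℂ) (hx : Continuous x) (hv : Continuous v) :
    Continuous fun a => xf n d (x a) i (v a) := by
  cases i with
  | zero => exact continuous_const
  | succ j =>
    by_cases h : j < n - 1
    · simp only [xf_succ n d _ j h, Matrix.toLin'_apply]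
      exact Continuous.matrix_mulVec ((continuous_apply (⟨j, h⟩ : Fin (n - 1))).comp hx) hv
    · simp only [xf, h, dite_false]
      exact continuous_const

lemma comps_cont (n : ℕ) (d : ℕ → ℕ) (i k : ℕ) (v : Fin (d i) → ℂ) :
    Continuous fun x => comps d (xf n d x) i k v := by
  induction k with
  | zero => exact continuous_const
  | succ k ih => exact xf_cont n d (i + k) id _ continuous_id ih

lemma isClosed_rank (n : ℕ) (d : ℕ → ℕ) (i k r : ℕ) :
    IsClosed {x | finrank ℂ (LinearMap.range (comps d (xf n d x) i k)) ≤ r} := by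
  rw [← isOpen_compl_iff]
  have hc : Continuous fun x => LinearMap.toContinuousLinearMap (comps d (xf n d x) i k) :=
    continuous_clm_apply.2 fun v => comps_cont n d i k v
  convert (isOpen_setOfPred_nat_le_rank (𝕜 := ℂ) (E := Fin (d i) → ℂ) (F := Fin (d (i + k)) → ℂ)
    (r + 1)).preimage hc using 1
  ext x
  change ¬ (finrank ℂ (LinearMap.range (comps d (xf n d x) i k)) ≤ r) ↔
    ((r + 1 : ℕ) : Cardinal) ≤ Module.rank ℂ (LinearMap.range (comps d (xf n d x) i k))
  rw [← Module.finrank_eq_rank, Nat.cast_le]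
  omega

lemma comps_conj {n : ℕ} (f f' : ∀ i, (Fin (d i) → ℂ) →ₗ[ℂ] (Fin (d (i + 1)) → ℂ))
    (g : ∀ i, (Fin (d i) → ℂ) ≃ₗ[ℂ] (Fin (d i) → ℂ))
    (h : ∀ i, 1 ≤ i → i + 1 ≤ n → f' i =
      (g (i + 1)).toLinearMap.comp ((f i).comp (g i).symm.toLinearMap))
    (i k : ℕ) (hi : 1 ≤ i) (hk : i + k ≤ n) : comps d f' i k =
      (g (i + k)).toLinearMap.comp ((comps d f i k).comp (g i).symm.toLinearMap) := by
  induction k with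
  | zero => refine LinearMap.ext fun v => ?_; simp [comps]
  | succ k ih =>
    refine LinearMap.ext fun v => ?_
    change f' (i + k) (comps d f' i k v) = g (i + k + 1) (f (i + k) (comps d f i k
      ((g i).symm v)))
    rw [ih (by omega), h (i + k) (by omega) (by omega)]
    simp

lemma rk_conj {n : ℕ} (f f' : ∀ i, (Fin (d i) → ℂ) →ₗ[ℂ] (Fin (d (i + 1)) → ℂ))
    (g : ∀ i, (Fin (d i) → ℂ) ≃ₗ[ℂ] (Fin (d i) → ℂ))
    (h : ∀ i, 1 ≤ i → i + 1 ≤ n → f' i =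
      (g (i + 1)).toLinearMap.comp ((f i).comp (g i).symm.toLinearMap))
    (i j : ℕ) (hi : 1 ≤ i) (hij : i ≤ j) (hj : j ≤ n) :
    finrank ℂ (LinearMap.range (comps d f' i (j - i))) = rk d f i j := by
  rw [comps_conj f f' g h i (j - i) hi (by omega), ← LinearMap.comp_assoc,
    LinearMap.range_comp_of_range_eq_top _ (LinearEquiv.range _), LinearMap.range_comp]
  exact LinearEquiv.finrank_map_eq (g (i + (j - i))) _

end Final

end OrbC


open OrbC

/-- in the split type, an `ε`-representation `N` lies in the closure of
the orbit of an `ε`-representation `M` under the group of isometries of the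
`σ`-compatible `ε`-form if and only if `r^M_{i,j} ≥ r^N_{i,j}` for all
`1 ≤ i ≤ j ≤ n`.  The graded space is `M^0 = M_1 ⊕ ⋯ ⊕ M_n` with `M_i = ℂ^{d i}`, the
ambient space `∏_{i=1}^{n-1} Hom(M_i, M_{i+1})` is identified with a product of matrix
spaces (with its standard topology) via `LinearMap.toMatrix'`. -/
theorem orbit_closure_iff_rank_sequences (n : ℕ) (hn : 1 ≤ n) (ε : ℂ)
    (hsplit : (Odd n ∧ ε = -1) ∨ (Even n ∧ ε = 1))
    (d : ℕ → ℕ) (hd0 : d 0 = 0) (hdn : ∀ i, n < i → d i = 0)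
    (B : (∀ i, Fin (d i) → ℂ) →ₗ[ℂ] (∀ i, Fin (d i) → ℂ) →ₗ[ℂ] ℂ)
    (hnd : ∀ v, (∀ w, B v w = 0) → v = 0)
    (hsym : ∀ v w, B v w = ε * B w v)
    (hgraded : ∀ (i j : ℕ) (v : Fin (d i) → ℂ) (w : Fin (d j) → ℂ), i + j ≠ n + 1 →
      B (Pi.single i v) (Pi.single j w) = 0)
    (fM fN : ∀ i, (Fin (d i) → ℂ) →ₗ[ℂ] (Fin (d (i + 1)) → ℂ))
    (hM : ∀ i, 1 ≤ i → i + 1 ≤ n → ∀ (v : Fin (d i) → ℂ) (w : Fin (d (n - i)) → ℂ),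
      B (Pi.single (i + 1) (fM i v)) (Pi.single (n - i) w)
        + B (Pi.single i v) (Pi.single (n - i + 1) (fM (n - i) w)) = 0)
    (hN : ∀ i, 1 ≤ i → i + 1 ≤ n → ∀ (v : Fin (d i) → ℂ) (w : Fin (d (n - i)) → ℂ),
      B (Pi.single (i + 1) (fN i v)) (Pi.single (n - i) w)
        + B (Pi.single i v) (Pi.single (n - i + 1) (fN (n - i) w)) = 0) :
    ((fun i : Fin (n - 1) => LinearMap.toMatrix' (fN (i.1 + 1))) ∈
      closure {x : ∀ i : Fin (n - 1), Matrix (Fin (d (i.1 + 2))) (Fin (d (i.1 + 1))) ℂ |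
        ∃ g : ∀ i, (Fin (d i) → ℂ) ≃ₗ[ℂ] (Fin (d i) → ℂ),
          (∀ i, 1 ≤ i → i ≤ n →
            ∀ (v : Fin (d i) → ℂ) (w : Fin (d (n + 1 - i)) → ℂ),
              B (Pi.single i (g i v)) (Pi.single (n + 1 - i) (g (n + 1 - i) w)) =
                B (Pi.single i v) (Pi.single (n + 1 - i) w)) ∧
          (∀ i : Fin (n - 1),
            x i = LinearMap.toMatrix'
              (((g (i.1 + 2)).toLinearMap.comp
                ((fM (i.1 + 1)).comp (g (i.1 + 1)).symm.toLinearMap)))) }) ↔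
      (∀ i j, 1 ≤ i → i ≤ j → j ≤ n → rk d fN i j ≤ rk d fM i j) := by
  classical
  constructor
  · intro hcl i j hi hij hj
    have hMc : ∀ x, (∃ g : ∀ i, (Fin (d i) → ℂ) ≃ₗ[ℂ] (Fin (d i) → ℂ), (∀ i : Fin (n - 1),
            x i = LinearMap.toMatrix'
              (((g (i.1 + 2)).toLinearMap.comp
                ((fM (i.1 + 1)).comp (g (i.1 + 1)).symm.toLinearMap)))) ) →
        finrank ℂ (LinearMap.range (comps d (xf n d x) i (j - i))) = rk d fM i j := by
      rintro x ⟨g, hg⟩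
      refine rk_conj (n := n) fM _ g ?_ i j hi hij hj
      intro i h1 h2
      obtain ⟨i, rfl⟩ : ∃ m, i = m + 1 := ⟨i - 1, by omega⟩
      rw [xf_succ n d x i (by omega), hg]
      simp
    have hNc : finrank ℂ (LinearMap.range (comps d (xf n d
        (fun i : Fin (n - 1) => LinearMap.toMatrix' (fN (i.1 + 1)))) i (j - i))) =
        rk d fN i j := by
      refine rk_conj (n := n) fN _ (fun i => LinearEquiv.refl ℂ _) ?_ i j hi hij hj
      intro i h1 h2
      obtain ⟨i, rfl⟩ : ∃ m, i = m + 1 := ⟨i - 1, by omega⟩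
      rw [xf_succ n d _ i (by omega)]
      simp
    have hc := closure_minimal (s := _) (fun x hx => ?_)
      (isClosed_rank n d i (j - i) (rk d fM i j)) hcl
    · rw [← hNc]; exact hc
    · obtain ⟨g, -, hg⟩ := hx
      exact (hMc x ⟨g, hg⟩).le
  · intro hle
    have := VV_fin (d := d) hdn
    have hMo := opF_isOp (hsplit := hsplit) (hd0 := hd0) (hdn := hdn) (hnd := hnd) (hsym := hsym)
      (hgraded := hgraded) fM hM
    have hNo := opF_isOp (hsplit := hsplit) (hd0 := hd0) (hdn := hdn) (hnd := hnd) (hsym := hsym)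
      (hgraded := hgraded) fN hN
    rw [← tup_opF n fN]
    refine abstract_main hMo (fun F => tup n d F ∈ closure _) ?_ ?_ _ hNo ?_
    · rintro N hN' ⟨g, hgω, hgM, hgP⟩
      apply subset_closure
      have hgP1 : ∀ i u, g (PPr d i u) = PPr d i (g u) := hgP
      have hgP2 : ∀ i u, g.symm (PPr d i u) = PPr d i (g.symm u) := by
        intro i u
        rw [LinearEquiv.symm_apply_eq, hgP1, LinearEquiv.apply_symm_apply]
      refine ⟨fun i => grE g hgP1 hgP2 i, ?_, ?_⟩
      · intro i h1 h2 v w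
        rw [← grE_single g hgP1 hgP2, ← grE_single g hgP1 hgP2]
        have e : B (JJ d (g (Pi.single i v))) (g (Pi.single (n + 1 - i) w)) =
          B (JJ d (Pi.single i v)) (Pi.single (n + 1 - i) w) := hgω _ _
        rw [grE_single g hgP1 hgP2, JJ_single, JJ_single] at e
        rw [grE_single g hgP1 hgP2 i]
        simp only [map_smul, LinearMap.smul_apply, smul_eq_mul] at e
        exact mul_left_cancel₀ (pow_ne_zero _ (by norm_num)) e
      · intro i
        unfold tup
        congr 1
        refine LinearMap.ext fun y => ?_
        change N (Pi.single (i.1 + 1) y) (i.1 + 2) = grE g hgP1 hgP2 (i.1 + 2) (fM (i.1 + 1)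
          ((grE g hgP1 hgP2 (i.1 + 1)).symm y))
        obtain ⟨z, rfl⟩ := (grE g hgP1 hgP2 (i.1 + 1)).surjective y
        rw [LinearEquiv.symm_apply_apply, ← grE_single g hgP1 hgP2, ← hgM, opF_single,
          grE_single g hgP1 hgP2, Pi.single_eq_same]
    · intro N A hN' hτ
      have ht : Filter.Tendsto (fun τ : ℂ => tup n d (N + τ • A)) (nhdsWithin 0 {0}ᶜ)
          (nhds (tup n d N)) := by
        have hc : Continuous (fun τ : ℂ => tup n d N + τ • tup n d A) := by fun_prop
        have h0 := hc.tendsto 0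
        simp only [zero_smul, add_zero] at h0
        refine (h0.mono_left nhdsWithin_le_nhds).congr fun τ => ?_
        exact (tup_add n N A τ).symm
      refine isClosed_closure.mem_of_tendsto ht ?_
      filter_upwards [self_mem_nhdsWithin] with τ h
      exact (hτ τ h).2
    · intro p q hp hq hpq
      have h := hle p (n + 1 - q) hp (by omega) (by omega)
      rw [rk_eq, rk_eq, show n + 1 - q - p = n + 1 - p - q by omega] at h
      exact h
end
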